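/- Let p be an odd prime, t ≥ 1 an integer, and q = p^t. Set m = 2, so V is the 4-dimensional symplectic space over F_q, and let A = A^2_{1,2}(q) be the incidence matrix over F_p between the totally isotropic 2-dimensional subspaces of V (the lines of the symplectic generalized quadrangle W(3,q)) and the 1-dimensional subspaces of V (the points). Then, as an equality of real numbers, rank_p(A) = 1 + α₁^t + α₂^t, where α₁ = p(p+1)²/4 + p(p+1)(p−1)√17/12 and α₂ = p(p+1)²/4 − p(p+1)(p−1)√17/12. -/

import Mathlib

open scoped Classical

noncomputable section

/-- The `2m`-dimensional standard symplectic space over `F_q = GaloisField p t`: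
pairs `(x, y)` of `m`-tuples. -/
abbrev SympV (p t m : ℕ) [Fact p.Prime] : Type :=
  (Fin m → GaloisField p t) × (Fin m → GaloisField p t)

/-- The nonsingular alternating bilinear form
`⟨(x,y),(x',y')⟩ = Σ_i (x_i y'_i − y_i x'_i)`. -/
def sform {p t m : ℕ} [Fact p.Prime] (v w : SympV p t m) : GaloisField p t :=
  ∑ i, (v.1 i * w.2 i - v.2 i * w.1 i)

/-- A subspace is totally isotropic if the form vanishes identically on it. -/
def IsTotIso {p t m : ℕ} [Fact p.Prime]
    (W : Submodule (GaloisField p t) (SympV p t m)) : Prop :=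
  ∀ u ∈ W, ∀ w ∈ W, sform u w = 0

instance {p t m : ℕ} [Fact p.Prime] :
    Finite (Submodule (GaloisField p t) (SympV p t m)) :=
  Finite.of_injective (fun W => (W : Set (SympV p t m))) SetLike.coe_injective

/-- Row index type: totally isotropic `r`-dimensional subspaces. -/
abbrev IsoFlats (p t m r : ℕ) [Fact p.Prime] : Type :=
  {W : Submodule (GaloisField p t) (SympV p t m) //
    IsTotIso W ∧ Module.finrank (GaloisField p t) W = r}

/-- Column index type: `1`-dimensional subspaces (points). -/
abbrev Pts (p t m : ℕ) [Fact p.Prime] : Type :=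
  {Z : Submodule (GaloisField p t) (SympV p t m) //
    Module.finrank (GaloisField p t) Z = 1}

noncomputable instance (p t m r : ℕ) [Fact p.Prime] : Fintype (IsoFlats p t m r) :=
  Fintype.ofFinite _

noncomputable instance (p t m : ℕ) [Fact p.Prime] : Fintype (Pts p t m) :=
  Fintype.ofFinite _

/-- The incidence matrix `A^m_{1,r}(p^t)` over `F_p` between totally isotropic
`r`-dimensional subspaces and points: entry `1` if the point lies in the flat. -/
def incMat (p t m r : ℕ) [Fact p.Prime] :
    Matrix (IsoFlats p t m r) (Pts p t m) (ZMod p) :=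
  fun W Z => if Z.val ≤ W.val then 1 else 0



set_option linter.unusedSectionVars false
set_option linter.unusedSimpArgs false
set_option linter.unnecessarySimpa false
set_option linter.all false

namespace W3
open MvPolynomial

section localalg
variable {k : Type} [Field k]

abbrev Pol (k : Type) [Field k] : Type := MvPolynomial (Fin 4) k

/-- linear form with coefficient vector `u` -/
def lf (u : Fin 4 → k) : Pol k := ∑ j, C (u j) * X j

/-- symplectic form on coefficient vectors -/
def B (f g : Fin 4 → k) : k := f 0 * g 1 - f 1 * g 0 + f 2 * g 3 - f 3 * g 2

/-- `be u j = B e_j u` -/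
def be (u : Fin 4 → k) : Fin 4 → k := ![u 1, -u 0, u 3, -u 2]

def D (u : Fin 4 → k) : Derivation k (Pol k) (Pol k) :=
  mkDerivation k (fun j => C (be u j) * lf u)

def Tv (u : Fin 4 → k) (r : k) : Pol k →ₐ[k] Pol k :=
  aeval (fun j => X j + C (r * be u j) * lf u)

def pp (k : Type) [Field k] (p : ℕ) : Ideal (Pol k) :=
  Ideal.span (Set.range fun j : Fin 4 => (X j : Pol k) ^ p)

def mon (a b c d : ℕ) : Pol k := X 0 ^ a * X 1 ^ b * X 2 ^ c * X 3 ^ d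

lemma B_eq (f u : Fin 4 → k) : B f u = ∑ j, f j * be u j := by
  simp [B, be, Fin.sum_univ_four]; ring

lemma B_self (u : Fin 4 → k) : B u u = 0 := by simp [B]; ring

lemma B_add_left (f g u : Fin 4 → k) : B (f + g) u = B f u + B g u := by
  simp [B]; ring

lemma B_smul_left (c : k) (g u : Fin 4 → k) : B (c • g) u = c * B g u := by
  simp [B]; ring

lemma B_swap (f g : Fin 4 → k) : B f g = - B g f := by simp [B]; ring

lemma lf_add (f g : Fin 4 → k) : lf (f + g) = lf f + lf g := by
  simp [lf, add_mul, Finset.sum_add_distrib]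

lemma lf_smul (c : k) (g : Fin 4 → k) : lf (c • g) = C c * lf g := by
  simp [lf, Finset.mul_sum, mul_assoc]

lemma D_X (u : Fin 4 → k) (j : Fin 4) : D u (X j) = C (be u j) * lf u := by
  simp [D, mkDerivation_X]

lemma D_C (u : Fin 4 → k) (c : k) : D u (C c) = 0 := by
  simpa using (D u).map_algebraMap c

lemma D_lf (u f : Fin 4 → k) : D u (lf f) = C (B f u) * lf u := by
  rw [lf, map_sum, B_eq]
  simp only [Derivation.leibniz, D_X, D_C, smul_eq_mul, map_sum, Finset.sum_mul, C_mul]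
  simp [mul_assoc]

lemma Tv_lf (u f : Fin 4 → k) (r : k) : Tv u r (lf f) = lf (f + (r * B f u) • u) := by
  rw [lf_add, lf_smul, B_eq]
  conv_lhs => rw [lf]
  rw [map_sum]
  simp only [Tv, map_mul, aeval_X, algHom_C, mul_add, Finset.sum_add_distrib, algebraMap_eq]
  congr 1
  rw [map_sum, Finset.mul_sum, Finset.sum_mul]
  refine Finset.sum_congr rfl fun j _ => ?_
  simp only [C_mul]; ring

section charp
variable (p : ℕ) [Fact p.Prime] [CharP k p]

lemma X_pow_mem_pp (j : Fin 4) : (X j : Pol k) ^ p ∈ pp k p :=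
  Ideal.subset_span ⟨j, rfl⟩

lemma lf_pow_mem_pp (u : Fin 4 → k) : (lf u) ^ p ∈ pp k p := by
  rw [lf, sum_pow_char]
  refine Ideal.sum_mem _ fun j _ => ?_
  rw [mul_pow]
  exact Ideal.mul_mem_left _ _ (X_pow_mem_pp p j)

lemma D_pow_char (u : Fin 4 → k) (F : Pol k) : D u (F ^ p) = 0 := by
  rw [Derivation.leibniz_pow]
  simp

lemma D_mem_pp (u : Fin 4 → k) {F : Pol k} (h : F ∈ pp k p) : D u F ∈ pp k p := by
  unfold pp at h ⊢
  refine Submodule.span_induction (p := fun x _ => D u x ∈ Ideal.span _) ?_ ?_ ?_ ?_ h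
  · rintro _ ⟨j, rfl⟩
    simp only []
    rw [D_pow_char]; exact Ideal.zero_mem _
  · simp
  · intro x y _ _ hx hy
    rw [map_add]; exact Ideal.add_mem _ hx hy
  · intro a x hx' hx
    rw [smul_eq_mul, Derivation.leibniz]
    refine Ideal.add_mem _ ?_ ?_
    · rw [smul_eq_mul]; exact Ideal.mul_mem_left _ _ hx
    · rw [smul_eq_mul]; exact Ideal.mul_mem_right _ _ hx'

lemma D_dvd (u : Fin 4 → k) (F : Pol k) : lf u ∣ D u F := by
  induction F using MvPolynomial.induction_on with
  | C a => rw [D_C]; exact dvd_zero _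
  | add F G hF hG => rw [map_add]; exact dvd_add hF hG
  | mul_X F j hF =>
    rw [Derivation.leibniz, D_X, smul_eq_mul, smul_eq_mul]
    exact dvd_add (Dvd.intro_left (F * C (be u j)) (by ring)) (dvd_mul_of_dvd_right hF _)

lemma D_iter_dvd (u : Fin 4 → k) (F : Pol k) (n : ℕ) : (lf u) ^ n ∣ (D u)^[n] F := by
  induction n with
  | zero => simp
  | succ n ih =>
    obtain ⟨G, hG⟩ := ih
    rw [Function.iterate_succ_apply', hG, Derivation.leibniz, Derivation.leibniz_pow, D_lf, B_self]
    simp only [map_zero, zero_mul, smul_zero, mul_zero, add_zero, smul_eq_mul]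
    rw [pow_succ]
    exact mul_dvd_mul_left _ (D_dvd u G)

/-- truncated exponential -/
def ex (u : Fin 4 → k) (r : k) (F : Pol k) : Pol k :=
  ∑ n ∈ Finset.range p, C (r ^ n * ((n.factorial : k))⁻¹) * (D u)^[n] F

lemma D_iter_mul_X (u : Fin 4 → k) (F : Pol k) (j : Fin 4) (n : ℕ) :
    (D u)^[n + 1] (F * X j) =
      (D u)^[n + 1] F * X j + ((n + 1 : ℕ) : Pol k) * ((D u)^[n] F * (C (be u j) * lf u)) := by
  have hD : D u (C (be u j) * lf u) = 0 := by
    rw [Derivation.leibniz, D_C, D_lf, B_self]; simp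
  induction n with
  | zero =>
    simp [Derivation.leibniz, D_X]; ring
  | succ n ih =>
    rw [Function.iterate_succ_apply', ih, map_add, Derivation.leibniz, Derivation.leibniz,
      Derivation.leibniz (D u) ((D u)^[n] F), hD, D_X, Derivation.map_natCast,
      Function.iterate_succ_apply' _ (n+1)]
    simp only [smul_eq_mul, mul_zero, zero_add, add_zero, ← Function.iterate_succ_apply']
    push_cast
    ring

lemma Tv_sub_ex (u : Fin 4 → k) (r : k) (F : Pol k) : Tv u r F - ex p u r F ∈ pp k p := by
  have hp : 0 < p := (Fact.out : p.Prime).pos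
  obtain ⟨q, rfl⟩ : ∃ q, p = q + 1 := ⟨p - 1, by omega⟩
  induction F using MvPolynomial.induction_on with
  | C a =>
    have : ex (q+1) u r (C a) = C a := by
      rw [ex, Finset.sum_range_succ', Finset.sum_eq_zero]
      · simp
      · intro n _
        rw [Function.iterate_succ_apply, D_C, iterate_map_zero, mul_zero]
    rw [this, Tv, aeval_C]; simp
  | add F G hF hG =>
    have : ex (q+1) u r (F + G) = ex (q+1) u r F + ex (q+1) u r G := by
      simp [ex, iterate_map_add, mul_add, Finset.sum_add_distrib]
    rw [this, map_add, add_sub_add_comm]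
    exact Ideal.add_mem _ hF hG
  | mul_X F j hF =>
    have key : ex (q+1) u r (F * X j) = ex (q+1) u r F * (X j + C (r * be u j) * lf u)
        - C (r ^ q * ((q.factorial : k))⁻¹) * (D u)^[q] F * (C (r * be u j) * lf u) := by
      have h1 : ex (q+1) u r (F * X j) = ex (q+1) u r F * X j +
          ∑ n ∈ Finset.range q, C (r ^ n * ((n.factorial : k))⁻¹) * (D u)^[n] F *
            (C (r * be u j) * lf u) := by
        rw [ex, Finset.sum_range_succ']
        conv_rhs => rw [ex, Finset.sum_range_succ']
        rw [add_mul, Finset.sum_mul]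
        simp only [Function.iterate_zero_apply]
        rw [add_right_comm, ← Finset.sum_add_distrib]
        congr 1
        · refine Finset.sum_congr rfl fun n hn => ?_
          rw [D_iter_mul_X, mul_add, mul_assoc]
          congr 1
          have hne : ((n + 1 : ℕ) : k) ≠ 0 := by
            intro h0
            rw [CharP.cast_eq_zero_iff k (q+1)] at h0
            have := Nat.le_of_dvd (by omega) h0
            have := Finset.mem_range.1 hn
            omega
          have hC : (((n + 1 : ℕ) : Pol k)) = C ((n + 1 : ℕ) : k) := by simp
          rw [hC]
          have : r ^ (n+1) * (((n+1).factorial : k))⁻¹ * ((n+1 : ℕ) : k)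
              = r ^ n * ((n.factorial : k))⁻¹ * r := by
            rw [Nat.factorial_succ, Nat.cast_mul, mul_inv]
            field_simp
            rw [pow_succ]
          calc _ = C (r ^ (n+1) * (((n+1).factorial : k))⁻¹ * ((n+1 : ℕ) : k)) *
              (D u)^[n] F * (C (be u j) * lf u) := by simp only [C_mul]; ring
            _ = _ := by rw [this]; simp only [C_mul]; ring
        · ring
      rw [h1, mul_add, ex, Finset.sum_range_succ, add_mul _ _ (C (r * be u j) * lf u),
        Finset.sum_mul _ _ (C (r * be u j) * lf u)]
      ring
    have hT : Tv u r (F * X j) = Tv u r F * (X j + C (r * be u j) * lf u) := by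
      rw [map_mul]; congr 1; simp [Tv]
    rw [key, hT]
    have h2 : C (r ^ q * ((q.factorial : k))⁻¹) * (D u)^[q] F * (C (r * be u j) * lf u)
        ∈ pp k (q+1) := by
      obtain ⟨G, hG⟩ := D_iter_dvd u F q
      rw [hG]
      have := Ideal.mul_mem_left (pp k (q+1))
        (C (r ^ q * ((q.factorial : k))⁻¹) * G * C (r * be u j)) (lf_pow_mem_pp (q+1) u)
      convert this using 1
      ring
    have h3 := Ideal.mul_mem_right (X j + C (r * be u j) * lf u) _ hF
    convert Ideal.add_mem _ h3 h2 using 1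
    ring

end charp
end localalg
end W3



namespace W3
open MvPolynomial

section fam
variable {k : Type} [Field k]

def e0 : Fin 4 → k := ![1,0,0,0]
def e1 : Fin 4 → k := ![0,1,0,0]
def e2 : Fin 4 → k := ![0,0,1,0]
def e3 : Fin 4 → k := ![0,0,0,1]

/-- polarised derivation -/
def Dsh (u w : Fin 4 → k) : Derivation k (Pol k) (Pol k) := D (u + w) - D u - D w

lemma deriv_mon (δ : Derivation k (Pol k) (Pol k)) (a b c d : ℕ) :
    δ (mon a b c d) = (a : Pol k) * mon (a-1) b c d * δ (X 0) + (b : Pol k) * mon a (b-1) c d * δ (X 1)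
      + (c : Pol k) * mon a b (c-1) d * δ (X 2) + (d : Pol k) * mon a b c (d-1) * δ (X 3) := by
  simp only [mon, Derivation.leibniz, Derivation.leibniz_pow, smul_eq_mul, nsmul_eq_mul]
  ring

lemma De0 (j : Fin 4) : D (e0 : Fin 4 → k) (X j) = ![0, -X 0, 0, 0] j := by
  rw [D_X]; fin_cases j <;> simp [be, e0, lf, Fin.sum_univ_four]
lemma De1 (j : Fin 4) : D (e1 : Fin 4 → k) (X j) = ![X 1, 0, 0, 0] j := by
  rw [D_X]; fin_cases j <;> simp [be, e1, lf, Fin.sum_univ_four]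
lemma De2 (j : Fin 4) : D (e2 : Fin 4 → k) (X j) = ![0, 0, 0, -X 2] j := by
  rw [D_X]; fin_cases j <;> simp [be, e2, lf, Fin.sum_univ_four]
lemma De3 (j : Fin 4) : D (e3 : Fin 4 → k) (X j) = ![0, 0, X 3, 0] j := by
  rw [D_X]; fin_cases j <;> simp [be, e3, lf, Fin.sum_univ_four]
lemma De12 (j : Fin 4) : Dsh (e1 : Fin 4 → k) e2 (X j) = ![X 2, 0, 0, -X 1] j := by
  rw [Dsh, Derivation.sub_apply, Derivation.sub_apply, D_X, D_X, D_X]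
  fin_cases j <;> simp [be, e1, e2, lf, Fin.sum_univ_four]

lemma De1_mon (a b c d : ℕ) : D (e1 : Fin 4 → k) (mon a b c d) = (a : Pol k) * mon (a-1) (b+1) c d := by
  rw [deriv_mon]; simp only [De1]; simp [mon]; ring
lemma De0_mon (a b c d : ℕ) : D (e0 : Fin 4 → k) (mon a b c d) = -((b : Pol k) * mon (a+1) (b-1) c d) := by
  rw [deriv_mon]; simp only [De0]; simp [mon]; ring
lemma De3_mon (a b c d : ℕ) : D (e3 : Fin 4 → k) (mon a b c d) = (c : Pol k) * mon a b (c-1) (d+1) := by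
  rw [deriv_mon]; simp only [De3]; simp [mon]; ring
lemma De2_mon (a b c d : ℕ) : D (e2 : Fin 4 → k) (mon a b c d) = -((d : Pol k) * mon a b (c+1) (d-1)) := by
  rw [deriv_mon]; simp only [De2]; simp [mon]; ring
lemma De12_mon (a b c d : ℕ) : Dsh (e1 : Fin 4 → k) e2 (mon a b c d) =
    (a : Pol k) * mon (a-1) b (c+1) d - (d : Pol k) * mon a (b+1) c (d-1) := by
  rw [deriv_mon]; simp only [De12]; simp [mon]; ring

structure Fam (p : ℕ) (w : ℕ → ℕ → ℕ → ℕ → Pol k) : Prop where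
  zero : ∀ a b c d, (p ≤ a ∨ p ≤ b ∨ p ≤ c ∨ p ≤ d) → w a b c d ∈ pp k p
  r1 : ∀ a b c d, D e1 (w a b c d) - (a : Pol k) * w (a-1) (b+1) c d ∈ pp k p
  r0 : ∀ a b c d, D e0 (w a b c d) + (b : Pol k) * w (a+1) (b-1) c d ∈ pp k p
  r3 : ∀ a b c d, D e3 (w a b c d) - (c : Pol k) * w a b (c-1) (d+1) ∈ pp k p
  r2 : ∀ a b c d, D e2 (w a b c d) + (d : Pol k) * w a b (c+1) (d-1) ∈ pp k p
  r5 : ∀ a b c d, Dsh e1 e2 (w a b c d) -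
    ((a : Pol k) * w (a-1) b (c+1) d - (d : Pol k) * w a (b+1) c (d-1)) ∈ pp k p

lemma mon_mem_pp {p : ℕ} {a b c d : ℕ} (h : p ≤ a ∨ p ≤ b ∨ p ≤ c ∨ p ≤ d) :
    (mon a b c d : Pol k) ∈ pp k p := by
  have hX : ∀ j : Fin 4, (X j : Pol k) ^ p ∈ pp k p := fun j => Ideal.subset_span ⟨j, rfl⟩
  have hX' : ∀ (j : Fin 4) (n : ℕ), p ≤ n → (X j : Pol k) ^ n ∈ pp k p := fun j n hn => by
    obtain ⟨m, rfl⟩ := Nat.exists_eq_add_of_le hn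
    rw [pow_add]; exact Ideal.mul_mem_right _ _ (hX j)
  unfold mon
  rcases h with h | h | h | h
  · exact Ideal.mul_mem_right _ _ (Ideal.mul_mem_right _ _ (Ideal.mul_mem_right _ _ (hX' 0 _ h)))
  · exact Ideal.mul_mem_right _ _ (Ideal.mul_mem_right _ _ (Ideal.mul_mem_left _ _ (hX' 1 _ h)))
  · exact Ideal.mul_mem_right _ _ (Ideal.mul_mem_left _ _ (hX' 2 _ h))
  · exact Ideal.mul_mem_left _ _ (hX' 3 _ h)

lemma fam_mon (p : ℕ) : Fam p (mon : ℕ → ℕ → ℕ → ℕ → Pol k) where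
  zero a b c d h := mon_mem_pp h
  r1 a b c d := by rw [De1_mon, sub_self]; exact Ideal.zero_mem _
  r0 a b c d := by rw [De0_mon, neg_add_cancel]; exact Ideal.zero_mem _
  r3 a b c d := by rw [De3_mon, sub_self]; exact Ideal.zero_mem _
  r2 a b c d := by rw [De2_mon, neg_add_cancel]; exact Ideal.zero_mem _
  r5 a b c d := by rw [De12_mon, sub_self]; exact Ideal.zero_mem _

def kap (a b c d : ℕ) : k :=
  (-1) ^ (b + d) * a.factorial * b.factorial * c.factorial * d.factorial

def dmon (p a b c d : ℕ) : Pol k := mon (p-1-b) (p-1-a) (p-1-d) (p-1-c)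

def wU (p a b c d : ℕ) : Pol k :=
  if a < p ∧ b < p ∧ c < p ∧ d < p then mon a b c d + C (kap a b c d) * dmon p a b c d else 0

variable (p : ℕ) [Fact p.Prime] [CharP k p]

lemma cast_dual {b : ℕ} (h : b < p) : ((p - 1 - b : ℕ) : k) = -((b : k) + 1) := by
  have : ((p - 1 - b : ℕ) : k) + (b + 1) = (p : k) := by
    have h2 : (p-1-b) + (b+1) = p := by omega
    exact_mod_cast congrArg (Nat.cast (R := k)) h2
  rw [CharP.cast_eq_zero k p] at this
  linear_combination this

lemma castP (n : ℕ) : (n : Pol k) = C (n : k) := by simp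

lemma pp_of_eq_zero {F : Pol k} (h : F = 0) : F ∈ pp k p := h ▸ Ideal.zero_mem _

/-- transport for the dual part -/
lemma D_Cmul (δ : Derivation k (Pol k) (Pol k)) (c : k) (F : Pol k) : δ (C c * F) = C c * δ F := by
  rw [← smul_eq_C_mul, ← smul_eq_C_mul, Derivation.map_smul]

lemma wU_red {a b c d : ℕ} (h : a < p ∧ b < p ∧ c < p ∧ d < p) :
    (wU p a b c d : Pol k) = mon a b c d + C (kap a b c d) * dmon p a b c d := if_pos h
lemma wU_nred {a b c d : ℕ} (h : ¬ (a < p ∧ b < p ∧ c < p ∧ d < p)) :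
    (wU p a b c d : Pol k) = 0 := if_neg h

lemma fam_wU : Fam p (wU p : ℕ → ℕ → ℕ → ℕ → Pol k) where
  zero a b c d h := by
    rw [wU_nred p (by omega)]; exact Ideal.zero_mem _
  r1 a b c d := by
    by_cases h : a < p ∧ b < p ∧ c < p ∧ d < p
    swap
    · rw [wU_nred p h, map_zero, zero_sub]
      by_cases ha : a = 0
      · subst ha; simp
      rcases Nat.lt_or_ge a (p+1) with h2 | h2
      · by_cases h3 : a = p
        · subst h3; simp
        · rw [wU_nred p (by omega)]; simp
      · rw [wU_nred p (by omega)]; simp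
    rw [wU_red p h, map_add, De1_mon, D_Cmul, dmon, De1_mon]
    rcases a with _ | a
    · simp only [Nat.cast_zero, zero_mul, sub_zero, zero_add]
      refine Ideal.mul_mem_left _ _ (Ideal.mul_mem_left _ _ (mon_mem_pp (by omega)))
    by_cases hb : b + 1 = p
    · rw [wU_nred p (by omega), show p - 1 - b = 0 by omega]
      simp only [Nat.cast_zero, zero_mul, mul_zero, add_zero, sub_zero]
      exact Ideal.mul_mem_left _ _ (mon_mem_pp (by omega))
    rw [Nat.add_sub_cancel, wU_red p (by omega), dmon]
    apply pp_of_eq_zero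
    rw [show p - 1 - b - 1 = p - 1 - (b+1) by omega, show p - 1 - (a+1) + 1 = p - 1 - a by omega,
      castP, castP, cast_dual p h.2.1, mul_add, add_sub_add_left_eq_sub, ← mul_assoc, ← mul_assoc,
      ← C_mul, ← C_mul, ← sub_mul, ← C_sub]
    convert zero_mul _
    rw [← C_0]; congr 1
    simp only [kap, Nat.factorial_succ]; push_cast; ring
  r0 a b c d := by
    by_cases h : a < p ∧ b < p ∧ c < p ∧ d < p
    swap
    · rw [wU_nred p h, map_zero, zero_add]
      by_cases ha : b = 0
      · subst ha; simp
      by_cases h3 : b = p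
      · subst h3; simp
      · rw [wU_nred p (by omega)]; simp
    rw [wU_red p h, map_add, De0_mon, D_Cmul, dmon, De0_mon]
    rcases b with _ | b
    · simp only [Nat.cast_zero, zero_mul, neg_zero, add_zero, zero_add]
      refine Ideal.mul_mem_left _ _ (neg_mem (Ideal.mul_mem_left _ _ (mon_mem_pp (by omega))))
    by_cases hb : a + 1 = p
    · rw [wU_nred p (by omega), show p - 1 - a = 0 by omega]
      simp only [Nat.cast_zero, zero_mul, mul_zero, add_zero, neg_zero]
      exact neg_mem (Ideal.mul_mem_left _ _ (mon_mem_pp (by omega)))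
    rw [Nat.add_sub_cancel, wU_red p (by omega), dmon]
    apply pp_of_eq_zero
    rw [show p - 1 - a - 1 = p - 1 - (a+1) by omega, show p - 1 - (b+1) + 1 = p - 1 - b by omega,
      castP, castP, cast_dual p h.1, mul_add, ← add_assoc, mul_neg]
    rw [show ∀ x y z : Pol k, - x + - y + x + z = z - y by intros; ring]
    rw [← mul_assoc, ← mul_assoc, ← C_mul, ← C_mul, ← sub_mul, ← C_sub]
    convert zero_mul _
    rw [← C_0]; congr 1
    simp only [kap, Nat.factorial_succ]; push_cast; ring
  r3 a b c d := by
    by_cases h : a < p ∧ b < p ∧ c < p ∧ d < p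
    swap
    · rw [wU_nred p h, map_zero, zero_sub]
      by_cases ha : c = 0
      · subst ha; simp
      by_cases h3 : c = p
      · subst h3; simp
      · rw [wU_nred p (by omega)]; simp
    rw [wU_red p h, map_add, De3_mon, D_Cmul, dmon, De3_mon]
    rcases c with _ | c
    · simp only [Nat.cast_zero, zero_mul, sub_zero, zero_add]
      refine Ideal.mul_mem_left _ _ (Ideal.mul_mem_left _ _ (mon_mem_pp (by omega)))
    by_cases hb : d + 1 = p
    · rw [wU_nred p (by omega), show p - 1 - d = 0 by omega]
      simp only [Nat.cast_zero, zero_mul, mul_zero, add_zero, sub_zero]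
      exact Ideal.mul_mem_left _ _ (mon_mem_pp (by omega))
    rw [Nat.add_sub_cancel, wU_red p (by omega), dmon]
    apply pp_of_eq_zero
    rw [show p - 1 - d - 1 = p - 1 - (d+1) by omega, show p - 1 - (c+1) + 1 = p - 1 - c by omega,
      castP, castP, cast_dual p h.2.2.2, mul_add, add_sub_add_left_eq_sub, ← mul_assoc, ← mul_assoc,
      ← C_mul, ← C_mul, ← sub_mul, ← C_sub]
    convert zero_mul _
    rw [← C_0]; congr 1
    simp only [kap, Nat.factorial_succ]; push_cast; ring
  r2 a b c d := by
    by_cases h : a < p ∧ b < p ∧ c < p ∧ d < p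
    swap
    · rw [wU_nred p h, map_zero, zero_add]
      by_cases ha : d = 0
      · subst ha; simp
      by_cases h3 : d = p
      · subst h3; simp
      · rw [wU_nred p (by omega)]; simp
    rw [wU_red p h, map_add, De2_mon, D_Cmul, dmon, De2_mon]
    rcases d with _ | d
    · simp only [Nat.cast_zero, zero_mul, neg_zero, add_zero, zero_add]
      refine Ideal.mul_mem_left _ _ (neg_mem (Ideal.mul_mem_left _ _ (mon_mem_pp (by omega))))
    by_cases hb : c + 1 = p
    · rw [wU_nred p (by omega), show p - 1 - c = 0 by omega]
      simp only [Nat.cast_zero, zero_mul, mul_zero, add_zero, neg_zero]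
      exact neg_mem (Ideal.mul_mem_left _ _ (mon_mem_pp (by omega)))
    rw [Nat.add_sub_cancel, wU_red p (by omega), dmon]
    apply pp_of_eq_zero
    rw [show p - 1 - c - 1 = p - 1 - (c+1) by omega, show p - 1 - (d+1) + 1 = p - 1 - d by omega,
      castP, castP, cast_dual p h.2.2.1, mul_add, ← add_assoc, mul_neg]
    rw [show ∀ x y z : Pol k, - x + - y + x + z = z - y by intros; ring]
    rw [← mul_assoc, ← mul_assoc, ← C_mul, ← C_mul, ← sub_mul, ← C_sub]
    convert zero_mul _
    rw [← C_0]; congr 1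
    simp only [kap, Nat.factorial_succ]; push_cast; ring
  r5 a b c d := by
    by_cases h : a < p ∧ b < p ∧ c < p ∧ d < p
    swap
    · have h1 : (a : Pol k) * wU p (a-1) b (c+1) d = 0 := by
        by_cases ha : a = 0
        · subst ha; simp
        by_cases h3 : a = p
        · subst h3; simp
        · rw [wU_nred p (by omega)]; simp
      have h2 : (d : Pol k) * wU p a (b+1) c (d-1) = 0 := by
        by_cases ha : d = 0
        · subst ha; simp
        by_cases h3 : d = p
        · subst h3; simp
        · rw [wU_nred p (by omega)]; simp
      rw [wU_nred p h, map_zero, h1, h2]; simp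
    rw [wU_red p h, map_add, De12_mon, D_Cmul, dmon, De12_mon]
    have h1 : (a : Pol k) * mon (a-1) b (c+1) d
        - C (kap a b c d) * (((p - 1 - c : ℕ) : Pol k) * mon (p-1-b) (p-1-a+1) (p-1-d) (p-1-c-1))
        - (a : Pol k) * wU p (a-1) b (c+1) d ∈ pp k p := by
      rcases a with _ | a
      · simp only [Nat.cast_zero, zero_mul, sub_zero, zero_sub]
        refine neg_mem (Ideal.mul_mem_left _ _ (Ideal.mul_mem_left _ _ (mon_mem_pp (by omega))))
      by_cases hc : c + 1 = p
      · rw [wU_nred p (by omega), show p - 1 - c = 0 by omega]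
        simp only [Nat.cast_zero, zero_mul, mul_zero, add_zero, sub_zero]
        exact Ideal.mul_mem_left _ _ (mon_mem_pp (by omega))
      rw [Nat.add_sub_cancel, wU_red p (by omega), dmon]
      apply pp_of_eq_zero
      rw [show p - 1 - c - 1 = p - 1 - (c+1) by omega, show p - 1 - (a+1) + 1 = p - 1 - a by omega,
        castP, castP, cast_dual p h.2.2.1, mul_add]
      rw [show ∀ x y z : Pol k, x - y - (x + z) = - y - z by intros; ring]
      rw [← mul_assoc, ← mul_assoc, ← C_mul, ← C_mul, ← neg_mul, ← sub_mul, ← C_neg, ← C_sub]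
      convert zero_mul _
      rw [← C_0]; congr 1
      simp only [kap, Nat.factorial_succ]; push_cast; ring
    have h2 : - ((d : Pol k) * mon a (b+1) c (d-1))
        + C (kap a b c d) * (((p - 1 - b : ℕ) : Pol k) * mon (p-1-b-1) (p-1-a) (p-1-d+1) (p-1-c))
        + (d : Pol k) * wU p a (b+1) c (d-1) ∈ pp k p := by
      rcases d with _ | d
      · simp only [Nat.cast_zero, zero_mul, neg_zero, add_zero, zero_add]
        refine (Ideal.mul_mem_left _ _ (Ideal.mul_mem_left _ _ (mon_mem_pp (by omega))))
      by_cases hc : b + 1 = p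
      · rw [wU_nred p (by omega), show p - 1 - b = 0 by omega]
        simp only [Nat.cast_zero, zero_mul, mul_zero, add_zero, sub_zero]
        exact neg_mem (Ideal.mul_mem_left _ _ (mon_mem_pp (by omega)))
      rw [Nat.add_sub_cancel, wU_red p (by omega), dmon]
      apply pp_of_eq_zero
      rw [show p - 1 - b - 1 = p - 1 - (b+1) by omega, show p - 1 - (d+1) + 1 = p - 1 - d by omega,
        castP, castP, cast_dual p h.2.1, mul_add]
      rw [show ∀ x y z : Pol k, -x + y + (x + z) = y + z by intros; ring]
      rw [← mul_assoc, ← mul_assoc, ← C_mul, ← C_mul, ← add_mul, ← C_add]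
      convert zero_mul _
      rw [← C_0]; congr 1
      simp only [kap, Nat.factorial_succ]; push_cast; ring
    convert add_mem h1 h2 using 1
    ring

end fam
end W3



namespace W3
open MvPolynomial

section gen
variable {k : Type} [Field k] (p : ℕ) [Fact p.Prime] [CharP k p]

structure Clo (A : Submodule k (Pol k)) : Prop where
  hpp : ∀ x ∈ pp k p, x ∈ A
  d0 : ∀ x ∈ A, D e0 x ∈ A
  d1 : ∀ x ∈ A, D e1 x ∈ A
  d2 : ∀ x ∈ A, D e2 x ∈ A
  d3 : ∀ x ∈ A, D e3 x ∈ A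
  d5 : ∀ x ∈ A, Dsh e1 e2 x ∈ A

variable {p}
variable {A : Submodule k (Pol k)} {w : ℕ → ℕ → ℕ → ℕ → Pol k}

lemma natCast_ne {n : ℕ} (h0 : 0 < n) (h : n < p) : (n : k) ≠ 0 := by
  intro h1
  rw [CharP.cast_eq_zero_iff k p] at h1
  exact absurd (Nat.le_of_dvd h0 h1) (by omega)

lemma mem_of_nat_mul {n : ℕ} (h0 : 0 < n) (h : n < p) {x : Pol k} (hx : (n : Pol k) * x ∈ A) :
    x ∈ A := by
  rw [castP, ← smul_eq_C_mul] at hx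
  exact (A.smul_mem_iff (natCast_ne h0 h)).1 hx



lemma mv1 (hA : Clo p A) (hw : Fam p w) {a b c d : ℕ} (h : w (a+1) b c d ∈ A) (ha : a + 1 < p) : w a (b+1) c d ∈ A := by
  have h1 := hA.hpp _ (hw.r1 (a+1) b c d)
  have h2 := A.sub_mem (hA.d1 _ h) h1
  rw [sub_sub_cancel] at h2
  exact mem_of_nat_mul (by omega) ha h2

lemma mv0 (hA : Clo p A) (hw : Fam p w) {a b c d : ℕ} (h : w a (b+1) c d ∈ A) (ha : b + 1 < p) : w (a+1) b c d ∈ A := by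
  have h1 := hA.hpp _ (hw.r0 a (b+1) c d)
  have h2 := A.sub_mem h1 (hA.d0 _ h)
  rw [add_sub_cancel_left] at h2
  exact mem_of_nat_mul (by omega) ha h2

lemma mv3 (hA : Clo p A) (hw : Fam p w) {a b c d : ℕ} (h : w a b (c+1) d ∈ A) (ha : c + 1 < p) : w a b c (d+1) ∈ A := by
  have h1 := hA.hpp _ (hw.r3 a b (c+1) d)
  have h2 := A.sub_mem (hA.d3 _ h) h1
  rw [sub_sub_cancel] at h2
  exact mem_of_nat_mul (by omega) ha h2

lemma mv2 (hA : Clo p A) (hw : Fam p w) {a b c d : ℕ} (h : w a b c (d+1) ∈ A) (ha : d + 1 < p) : w a b (c+1) d ∈ A := by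
  have h1 := hA.hpp _ (hw.r2 a b c (d+1))
  have h2 := A.sub_mem h1 (hA.d2 _ h)
  rw [add_sub_cancel_left] at h2
  exact mem_of_nat_mul (by omega) ha h2

lemma mv5 (hA : Clo p A) (hw : Fam p w) {a b c d : ℕ} (h : w a b c d ∈ A) :
    (a : Pol k) * w (a-1) b (c+1) d - (d : Pol k) * w a (b+1) c (d-1) ∈ A := by
  have h1 := hA.hpp _ (hw.r5 a b c d)
  have h2 := A.sub_mem (hA.d5 _ h) h1
  rwa [sub_sub_cancel] at h2

lemma conn_ab (hA : Clo p A) (hw : Fam p w) {a b c d : ℕ} (h : w a b c d ∈ A) (ha : a < p) (hb : b < p) :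
    ∀ {a' b' : ℕ}, a' + b' = a + b → a' < p → b' < p → w a' b' c d ∈ A := by
  have up : ∀ n, n ≤ b → a + n < p → w (a+n) (b-n) c d ∈ A := by
    intro n
    induction n with
    | zero => intro _ _; simpa using h
    | succ n ih =>
      intro h1 h2
      have := ih (by omega) (by omega)
      rw [show b - n = (b - (n+1)) + 1 by omega] at this
      exact mv0 hA hw this (by omega)
  have dn : ∀ n, n ≤ a → b + n < p → w (a-n) (b+n) c d ∈ A := by
    intro n
    induction n with
    | zero => intro _ _; simpa using h
    | succ n ih =>
      intro h1 h2
      have := ih (by omega) (by omega)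
      rw [show a - n = (a - (n+1)) + 1 by omega] at this
      exact mv1 hA hw this (by omega)
  intro a' b' hs h1 h2
  rcases Nat.le_total a a' with hle | hle
  · have := up (a' - a) (by omega) (by omega)
    rwa [show a + (a' - a) = a' by omega, show b - (a' - a) = b' by omega] at this
  · have := dn (a - a') (by omega) (by omega)
    rwa [show a - (a - a') = a' by omega, show b + (a - a') = b' by omega] at this

lemma conn_cd (hA : Clo p A) (hw : Fam p w) {a b c d : ℕ} (h : w a b c d ∈ A) (ha : c < p) (hb : d < p) :
    ∀ {c' d' : ℕ}, c' + d' = c + d → c' < p → d' < p → w a b c' d' ∈ A := by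
  have up : ∀ n, n ≤ d → c + n < p → w a b (c+n) (d-n) ∈ A := by
    intro n
    induction n with
    | zero => intro _ _; simpa using h
    | succ n ih =>
      intro h1 h2
      have := ih (by omega) (by omega)
      rw [show d - n = (d - (n+1)) + 1 by omega] at this
      exact mv2 hA hw this (by omega)
  have dn : ∀ n, n ≤ c → d + n < p → w a b (c-n) (d+n) ∈ A := by
    intro n
    induction n with
    | zero => intro _ _; simpa using h
    | succ n ih =>
      intro h1 h2
      have := ih (by omega) (by omega)
      rw [show c - n = (c - (n+1)) + 1 by omega] at this
      exact mv3 hA hw this (by omega)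
  intro c' d' hs h1 h2
  rcases Nat.le_total c c' with hle | hle
  · have := up (c' - c) (by omega) (by omega)
    rwa [show c + (c' - c) = c' by omega, show d - (c' - c) = d' by omega] at this
  · have := dn (c - c') (by omega) (by omega)
    rwa [show c - (c - c') = c' by omega, show d + (c - c') = d' by omega] at this


/-- all family members of type `(n, m)` are in `A` -/
def All (A : Submodule k (Pol k)) (w : ℕ → ℕ → ℕ → ℕ → Pol k) (n m : ℕ) : Prop :=
  ∀ a b c d, a + b = n → c + d = m → w a b c d ∈ A

lemma all_of_one (hA : Clo p A) (hw : Fam p w) {a b c d : ℕ} (h : w a b c d ∈ A) (ha : a < p) (hb : b < p) (hc : c < p)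
    (hd : d < p) : All A w (a+b) (c+d) := by
  intro a' b' c' d' h1 h2
  by_cases hr : a' < p ∧ b' < p ∧ c' < p ∧ d' < p
  · have := conn_ab hA hw h ha hb h1 hr.1 hr.2.1
    exact conn_cd hA hw this hc hd h2 hr.2.2.1 hr.2.2.2
  · exact hA.hpp _ (hw.zero _ _ _ _ (by omega))

lemma all_of_nored (hA : Clo p A) (hw : Fam p w) {n m : ℕ} (h : 2 * p ≤ n + 1 ∨ 2 * p ≤ m + 1) : All A w n m := by
  intro a' b' c' d' h1 h2
  exact hA.hpp _ (hw.zero _ _ _ _ (by omega))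

lemma all_down (hA : Clo p A) (hw : Fam p w) {n m : ℕ} (hn : n + 3 ≤ 2 * p) (h : All A w (n+1) m)
    (h' : m = 0 ∨ All A w (n+2) (m-1)) : All A w n (m+1) := by
  by_cases hr : 2 * p ≤ m + 2
  · exact all_of_nored hA hw (by omega)
  obtain ⟨a, b, hab, ha, hb⟩ : ∃ a b, a + b = n ∧ a + 1 < p ∧ b < p :=
    ⟨min n (p-2), n - min n (p-2), by omega, by
      have := (Fact.out : p.Prime).two_le
      omega, by omega⟩
  obtain ⟨c, d, hcd, hc, hd⟩ : ∃ c d, c + d = m ∧ c + 1 < p ∧ d < p :=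
    ⟨m - min m (p-1), min m (p-1), by omega, by
      have := (Fact.out : p.Prime).two_le
      omega, by omega⟩
  have h1 := mv5 hA hw (h (a+1) b c d (by omega) hcd)
  have h2 : (d : Pol k) * w (a+1) (b+1) c (d-1) ∈ A := by
    rw [castP, ← smul_eq_C_mul]
    rcases Nat.eq_zero_or_pos d with hd0 | hd0
    · subst hd0; simp
    · refine A.smul_mem _ ?_
      rcases h' with h' | h'
      · omega
      · exact h' _ _ _ _ (by omega) (by omega)
  have h3 := A.add_mem h1 h2
  rw [sub_add_cancel, Nat.add_sub_cancel] at h3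
  have h4 := mem_of_nat_mul (by omega) ha h3
  have := all_of_one hA hw h4 (by omega) (by omega) (by omega) (by omega)
  rwa [hab, show c + 1 + d = m + 1 by omega] at this

lemma all_up (hA : Clo p A) (hw : Fam p w) {n m : ℕ} (hn : m + 3 ≤ 2 * p) (h : All A w n (m+1))
    (h' : n = 0 ∨ All A w (n-1) (m+2)) : All A w (n+1) m := by
  by_cases hr : 2 * p ≤ n + 2
  · exact all_of_nored hA hw (by omega)
  obtain ⟨d, c, hcd, hd, hc⟩ : ∃ d c, c + d = m ∧ d + 1 < p ∧ c < p :=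
    ⟨min m (p-2), m - min m (p-2), by omega, by
      have := (Fact.out : p.Prime).two_le
      omega, by omega⟩
  obtain ⟨b, a, hab, hb, ha⟩ : ∃ b a, a + b = n ∧ b + 1 < p ∧ a < p :=
    ⟨n - min n (p-1), min n (p-1), by omega, by
      have := (Fact.out : p.Prime).two_le
      omega, by omega⟩
  have h1 := mv5 hA hw (h a b c (d+1) (by omega) (by omega))
  have h2 : (a : Pol k) * w (a-1) b (c+1) (d+1) ∈ A := by
    rw [castP, ← smul_eq_C_mul]
    rcases Nat.eq_zero_or_pos a with hd0 | hd0
    · subst hd0; simp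
    · refine A.smul_mem _ ?_
      rcases h' with h' | h'
      · omega
      · exact h' _ _ _ _ (by omega) (by omega)
  have h3 := A.sub_mem h2 h1
  rw [sub_sub_cancel, Nat.add_sub_cancel] at h3
  have h4 := mem_of_nat_mul (by omega) hd h3
  have := all_of_one hA hw h4 (by omega) (by omega) (by omega) (by omega)
  rwa [hcd, show a + (b + 1) = n + 1 by omega] at this

lemma all_downs (hA : Clo p A) (hw : Fam p w) {n l : ℕ} (hnp : n + 2 ≤ 2 * p) (hn : n + 1 ≤ l) (h0 : All A w n (l-n))
    (h1 : All A w (n+1) (l-n-1)) : ∀ j ≤ n, All A w j (l - j) := by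
  have : ∀ i, i ≤ n → All A w (n-i) (l-(n-i)) ∧ All A w (n-i+1) (l-(n-i)-1) := by
    intro i
    induction i with
    | zero => intro _; exact ⟨h0, h1⟩
    | succ i ih =>
      intro hi
      obtain ⟨g0, g1⟩ := ih (by omega)
      rw [show n - i = n - (i+1) + 1 by omega] at g0 g1
      have := all_down hA hw (n := n - (i+1)) (by omega) g0 (Or.inr g1)
      rw [show l - (n - (i + 1) + 1) + 1 = l - (n - (i+1)) by omega] at this
      refine ⟨this, ?_⟩
      rwa [show l - (n - (i+1)) - 1 = l - (n - (i + 1) + 1) by omega]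
  intro j hj
  have := (this (n - j) (by omega)).1
  rwa [show n - (n - j) = j by omega] at this

lemma all_ups (hA : Clo p A) (hw : Fam p w) {n l : ℕ} (hnp : l ≤ n + 2 * p - 1) (hn : n + 1 ≤ l) (h0 : All A w n (l-n))
    (h1 : All A w (n+1) (l-n-1)) : ∀ j, n ≤ j → j ≤ l → All A w j (l - j) := by
  have hp2 := (Fact.out : p.Prime).two_le
  have : ∀ i, n + i + 1 ≤ l → All A w (n+i) (l-(n+i)) ∧ All A w (n+i+1) (l-(n+i)-1) := by
    intro i
    induction i with
    | zero => intro _; exact ⟨h0, h1⟩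
    | succ i ih =>
      intro hi
      obtain ⟨g0, g1⟩ := ih (by omega)
      rw [show l - (n+i) - 1 = l - (n+(i+1)) by omega] at g1
      refine ⟨g1, ?_⟩
      obtain ⟨m, hm⟩ : ∃ m, l - (n + (i+1)) = m + 1 := ⟨l - (n + (i+1)) - 1, by omega⟩
      rw [hm] at g1 ⊢
      refine all_up hA hw (by omega) g1 (Or.inr ?_)
      rwa [show n + (i + 1) - 1 = n + i by omega, show m + 1 - 1 + 2 = l - (n+i) by omega]
  intro j hj hj2
  rcases Nat.lt_or_ge j l with h | h
  · have := (this (j - n) (by omega)).1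
    rwa [show n + (j - n) = j by omega] at this
  · have := (this (l - n - 1) (by omega)).2
    rwa [show n + (l - n - 1) + 1 = j by omega, show l - (n + (l-n-1)) - 1 = l - j by omega] at this

lemma all_total (hA : Clo p A) (hw : Fam p w) {n l : ℕ} (h2 : n + 2 ≤ 2 * p) (h3 : l ≤ n + 2 * p - 1) (hn : n + 1 ≤ l)
    (h0 : All A w n (l-n)) (h1 : All A w (n+1) (l-n-1)) (a b c d : ℕ) (hs : a + b + c + d = l) :
    w a b c d ∈ A := by
  rcases Nat.le_total (a+b) n with h | h
  · exact all_downs hA hw h2 hn h0 h1 (a+b) h _ _ _ _ rfl (by omega)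
  · exact all_ups hA hw h3 hn h0 h1 (a+b) h (by omega) _ _ _ _ rfl (by omega)
end gen
end W3



namespace W3
open MvPolynomial

section gen2
variable {k : Type} [Field k] {p : ℕ} [Fact p.Prime] [CharP k p]
variable {A : Submodule k (Pol k)}

lemma gen_ft (hp : 3 ≤ p) (hA : Clo p A) (h : mon (p-2) 0 0 0 ∈ A) {a b c d : ℕ}
    (hs : a + b + c + d = p - 2) : mon a b c d ∈ A := by
  have hw := fam_mon (k := k) p
  have h0 := all_of_one hA hw h (by omega) (by omega) (by omega) (by omega)
  have h1 : All A mon (p-3) 1 := all_down hA hw (by omega)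
    (by rwa [show p - 3 + 1 = p - 2 + 0 by omega]) (Or.inl rfl)
  refine all_total hA hw (n := p-3) (l := p-2) (by omega) (by omega) (by omega) ?_ ?_ _ _ _ _ hs
  · rwa [show p - 2 - (p - 3) = 1 by omega]
  · rwa [show p - 2 - (p - 3) - 1 = 0 + 0 by omega, show p - 3 + 1 = p - 2 + 0 by omega]

lemma gen_tt (hp : 3 ≤ p) (hA : Clo p A) (h : mon (p-2) 0 1 0 ∈ A) {a b c d : ℕ}
    (hs : a + b + c + d = p - 1) : mon a b c d ∈ A := by
  have hw := fam_mon (k := k) p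
  have h0 := all_of_one hA hw h (by omega) (by omega) (by omega) (by omega)
  have h2 := mv5 hA hw (h0 0 (p-2) 0 1 (by omega) (by omega))
  simp only [Nat.cast_zero, zero_mul, zero_sub, Nat.cast_one, one_mul, neg_mem_iff] at h2
  have h1 := all_of_one hA hw h2 (by omega) (by omega) (by omega) (by omega)
  refine all_total hA hw (n := p-2) (l := p-1) (by omega) (by omega) (by omega) ?_ ?_ _ _ _ _ hs
  · rwa [show p - 1 - (p - 2) = 1 + 0 by omega]
  · rwa [show p - 1 - (p - 2) - 1 = 0 + (1-1) by omega, show p - 2 + 1 = 0 + (p - 2 + 1) by omega]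

lemma gen_tf (hp : 3 ≤ p) (hA : Clo p A) (h : mon 0 (p-1) 1 (p-1) ∈ A) {a b c d : ℕ}
    (hs : a + b + c + d = 2*p - 1) : mon a b c d ∈ A := by
  have hw := fam_mon (k := k) p
  have h0 := all_of_one hA hw h (by omega) (by omega) (by omega) (by omega)
  have h2 := mv5 hA hw (h0 1 (p-2) (p-1) 1 (by omega) (by omega))
  have h3 : (mon (1-1) (p-2) (p-1+1) 1 : Pol k) ∈ A := hA.hpp _ (hw.zero _ _ _ _ (by omega))
  simp only [Nat.cast_one, one_mul] at h2
  rw [A.sub_mem_iff_right h3] at h2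
  have h1 := all_of_one hA hw h2 (by omega) (by omega) (by omega) (by omega)
  refine all_total hA hw (n := p-1) (l := 2*p-1) (by omega) (by omega) (by omega) ?_ ?_ _ _ _ _ hs
  · rw [zero_add] at h0
    rwa [show 2*p - 1 - (p - 1) = 1 + (p-1) by omega]
  · rwa [show 2*p - 1 - (p - 1) - 1 = p - 1 + (1-1) by omega,
      show p - 1 + 1 = 1 + (p - 2 + 1) by omega]

lemma wilson_k : (((p-1).factorial : ℕ) : k) = -1 := by
  have h := ZMod.wilsons_lemma p
  have h2 := congrArg (ZMod.castHom (dvd_refl p) k) h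
  rwa [map_natCast, map_neg, map_one] at h2

lemma wilson2_k (hp : 3 ≤ p) : (((p-2).factorial : ℕ) : k) = 1 := by
  have h := wilson_k (k := k) (p := p)
  rw [show p - 1 = p - 2 + 1 by omega, Nat.factorial_succ, Nat.cast_mul,
    show p - 2 + 1 = p - 1 - 0 by omega, cast_dual p (by omega)] at h
  simpa using h

lemma gen_ff (hp : 3 ≤ p) (hodd : Odd p) (hA : Clo p A) (h : mon 0 (p-1) 0 (p-1) ∈ A) {a b c d : ℕ}
    (hs : a + b + c + d = 2*p - 2) : wU p a b c d ∈ A := by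
  have hw := fam_wU (k := k) p
  have hev : Even (p-1) := by
    obtain ⟨n, hn⟩ := hodd; exact ⟨n, by omega⟩
  have h00 : (wU p 0 (p-1) 0 (p-1) : Pol k) ∈ A := by
    rw [wU_red p (by omega), dmon, ← smul_eq_C_mul]
    simp only [Nat.sub_self, Nat.sub_zero]
    exact A.add_mem h (A.smul_mem _ h)
  have h0 := all_of_one hA hw h00 (by omega) (by omega) (by omega) (by omega)
  have h2 := mv5 hA hw (h0 1 (p-2) (p-2) 1 (by omega) (by omega))
  have e1 : (wU p 0 (p-2) (p-1) 1 : Pol k) = mon 0 (p-2) (p-1) 1 - mon 1 (p-1) (p-2) 0 := by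
    rw [wU_red p (by omega), dmon, kap, wilson_k, wilson2_k hp,
      show p - 1 - (p-2) = 1 by omega, show p - 1 - 1 = p - 2 by omega,
      show p - 2 + 1 = p - 1 by omega, hev.neg_one_pow]
    simp [sub_eq_add_neg]
  have e2 : (wU p 1 (p-1) (p-2) 0 : Pol k) = -wU p 0 (p-2) (p-1) 1 := by
    rw [e1, wU_red p (by omega), dmon, kap, wilson_k, wilson2_k hp,
      show p - 1 - (p-2) = 1 by omega, show p - 1 - 1 = p - 2 by omega,
      show p - 1 + 0 = p - 1 by omega, hev.neg_one_pow]
    simp [sub_eq_add_neg]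
  simp only [Nat.cast_one, one_mul, Nat.sub_self, show p - 2 + 1 = p - 1 by omega] at h2
  rw [e2, sub_neg_eq_add, ← two_mul] at h2
  have h3 : (wU p 0 (p-2) (p-1) 1 : Pol k) ∈ A :=
    mem_of_nat_mul (n := 2) (p := p) (by omega) (by omega) (by simpa using h2)
  have h1 := all_of_one hA hw h3 (by omega) (by omega) (by omega) (by omega)
  refine all_total hA hw (n := p-2) (l := 2*p-2) (by omega) (by omega) (by omega) ?_ ?_ _ _ _ _ hs
  · rwa [show 2*p - 2 - (p - 2) = p - 1 + 1 by omega, show p - 2 = 0 + (p-2) by omega]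
  · rwa [show 2*p - 2 - (p - 2) - 1 = 0 + (p-1) by omega,
      show p - 2 + 1 = 0 + (p-1) by omega]

end gen2
end W3



namespace W3
open MvPolynomial

section Usec
variable {k : Type} [Field k]

abbrev hom (k : Type) [Field k] (n : ℕ) : Submodule k (Pol k) := homogeneousSubmodule (Fin 4) k n

lemma mon_hom (a b c d : ℕ) : (mon a b c d : Pol k) ∈ hom k (a+b+c+d) := by
  rw [mem_homogeneousSubmodule, mon]
  have h : ∀ (j : Fin 4) (n : ℕ), ((X j : Pol k)^n).IsHomogeneous n := by
    intro j n
    simpa using (isHomogeneous_X k j).pow n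
  exact (((h 0 a).mul (h 1 b)).mul (h 2 c)).mul (h 3 d)

lemma mon_hom' {a b c d n : ℕ} (h : a + b + c + d = n) : (mon a b c d : Pol k) ∈ hom k n :=
  h ▸ mon_hom a b c d

lemma C_mul_hom {n : ℕ} (c : k) {x : Pol k} (h : x ∈ hom k n) : C c * x ∈ hom k n := by
  rw [← smul_eq_C_mul]; exact Submodule.smul_mem _ _ h

lemma lf_hom (u : Fin 4 → k) : lf u ∈ hom k 1 := by
  refine Submodule.sum_mem _ fun j _ => C_mul_hom _ (isHomogeneous_X k j)

lemma deriv_hom (δ : Derivation k (Pol k) (Pol k)) (h : ∀ j, δ (X j) ∈ hom k 1) {n : ℕ}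
    {x : Pol k} (hx : x ∈ hom k n) : δ x ∈ hom k n := by
  have key : ∀ y : Pol k, δ y = ∑ j, pderiv j y * δ (X j) := by
    intro y
    have hg : ∀ (d0 d1 d2 d3 : Pol k), ∀ z : Pol k,
        (d0 • pderiv 0 + d1 • pderiv 1 + d2 • pderiv 2 + d3 • pderiv 3 :
          Derivation k (Pol k) (Pol k)) z
        = pderiv 0 z * d0 + pderiv 1 z * d1 + pderiv 2 z * d2 + pderiv 3 z * d3 := by
      intro d0 d1 d2 d3 z
      simp only [Derivation.add_apply, Derivation.smul_apply, smul_eq_mul]; ring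
    have : δ = δ (X 0) • pderiv 0 + δ (X 1) • pderiv 1 + δ (X 2) • pderiv 2 +
        δ (X 3) • pderiv 3 := by
      apply MvPolynomial.derivation_ext
      intro i
      rw [hg]
      fin_cases i <;> simp [pderiv_X, Pi.single_apply]
    rw [Fin.sum_univ_four, ← hg, ← this]
  rw [key]
  refine Submodule.sum_mem _ fun j _ => ?_
  rcases Nat.eq_zero_or_pos n with h0 | h0
  · subst h0
    rw [mem_homogeneousSubmodule, ← totalDegree_zero_iff_isHomogeneous, totalDegree_eq_zero_iff_eq_C] at hx
    rw [hx, pderiv_C, zero_mul]; exact Submodule.zero_mem _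
  · have := (IsHomogeneous.pderiv (i := j) hx).mul (h j)
    rwa [Nat.sub_add_cancel h0] at this

lemma D_hom (u : Fin 4 → k) {n : ℕ} {x : Pol k} (hx : x ∈ hom k n) : D u x ∈ hom k n :=
  deriv_hom _ (fun j => by rw [D_X]; exact C_mul_hom _ (lf_hom u)) hx

lemma Dsh_hom (u w : Fin 4 → k) {n : ℕ} {x : Pol k} (hx : x ∈ hom k n) : Dsh u w x ∈ hom k n :=
  Submodule.sub_mem _ (Submodule.sub_mem _ (D_hom _ hx) (D_hom _ hx)) (D_hom _ hx)

lemma Tv_hom (u : Fin 4 → k) (r : k) {n : ℕ} {x : Pol k} (hx : x ∈ hom k n) :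
    Tv u r x ∈ hom k n := by
  have := IsHomogeneous.aeval hx (fun j => X j + C (r * be u j) * lf u) (n := 1)
    (fun j => Submodule.add_mem (hom k 1) (isHomogeneous_X k j) (C_mul_hom _ (lf_hom u)))
  rwa [one_mul] at this

variable (k) (p : ℕ)

def U : Submodule k (Pol k) :=
  Submodule.span k {x | ∃ a b c d, a + b + c + d = 2*p-2 ∧ x = wU p a b c d} ⊔
    ((pp k p).restrictScalars k ⊓ hom k (2*p-2))

variable {k}
variable [Fact p.Prime] [CharP k p]

lemma wU_hom {a b c d : ℕ} (h : a + b + c + d = 2*p-2) : (wU p a b c d : Pol k) ∈ hom k (2*p-2) := by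
  unfold wU
  split_ifs with h1
  · refine Submodule.add_mem _ (mon_hom' h) (C_mul_hom _ (mon_hom' ?_))
    omega
  · exact Submodule.zero_mem _

lemma U_hom {x : Pol k} (h : x ∈ U k p) : x ∈ hom k (2*p-2) := by
  refine (sup_le (Submodule.span_le.2 ?_) inf_le_right : U k p ≤ hom k (2*p-2)) h
  rintro _ ⟨a, b, c, d, h, rfl⟩
  exact wU_hom p h

lemma wU_U {a b c d : ℕ} (h : a + b + c + d = 2*p-2) : (wU p a b c d : Pol k) ∈ U k p :=
  Submodule.mem_sup_left (Submodule.subset_span ⟨_, _, _, _, h, rfl⟩)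

lemma pp_U {x : Pol k} (h : x ∈ pp k p) (h' : x ∈ hom k (2*p-2)) : x ∈ U k p :=
  Submodule.mem_sup_right ⟨h, h'⟩

lemma U_closed (δ : Derivation k (Pol k) (Pol k)) (hX : ∀ j, δ (X j) ∈ hom k 1)
    (hpp : ∀ x ∈ pp k p, δ x ∈ pp k p)
    (h : ∀ a b c d, a + b + c + d = 2*p-2 → ∃ y ∈ U k p, δ (wU p a b c d) - y ∈ pp k p)
    {x : Pol k} (hx : x ∈ U k p) : δ x ∈ U k p := by
  have : U k p ≤ (U k p).comap (δ : Pol k →ₗ[k] Pol k) := by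
    refine sup_le (Submodule.span_le.2 ?_) ?_
    · rintro _ ⟨a, b, c, d, hs, rfl⟩
      obtain ⟨y, hy, h1⟩ := h a b c d hs
      have := (U k p).add_mem hy (pp_U p h1
        (Submodule.sub_mem _ (deriv_hom δ hX (wU_hom p hs)) (U_hom p hy)))
      rwa [add_sub_cancel] at this
    · rintro y ⟨h1, h2⟩
      exact pp_U p (hpp _ h1) (deriv_hom δ hX h2)
  exact this hx

lemma D_X_hom (u : Fin 4 → k) (j : Fin 4) : D u (X j) ∈ hom k 1 := D_hom u (isHomogeneous_X k j)
lemma Dsh_X_hom (u w : Fin 4 → k) (j : Fin 4) : Dsh u w (X j) ∈ hom k 1 :=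
  Dsh_hom u w (isHomogeneous_X k j)
lemma Dsh_mem_pp (u w : Fin 4 → k) {x : Pol k} (h : x ∈ pp k p) : Dsh u w x ∈ pp k p :=
  Submodule.sub_mem _ (Submodule.sub_mem _ (D_mem_pp p _ h) (D_mem_pp p _ h)) (D_mem_pp p _ h)

lemma nat_wU {n a b c d : ℕ} (h : n ≠ 0 → a + b + c + d = 2*p-2) :
    (n : Pol k) * wU p a b c d ∈ U k p := by
  by_cases h0 : n = 0
  · subst h0; simp
  · rw [castP, ← smul_eq_C_mul]; exact Submodule.smul_mem _ _ (wU_U p (h h0))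

def Pres : Submodule k (Derivation k (Pol k) (Pol k)) where
  carrier := {δ | ∀ x ∈ U k p, δ x ∈ U k p}
  zero_mem' := fun x _ => by simp
  add_mem' := fun h h' x hx => Submodule.add_mem _ (h x hx) (h' x hx)
  smul_mem' := fun c δ h x hx => Submodule.smul_mem _ c (h x hx)

lemma pres0 : D e0 ∈ Pres (k := k) p := fun x hx => by
  refine U_closed p _ (D_X_hom _) (fun x h => D_mem_pp p _ h) ?_ hx
  intro a b c d hs
  refine ⟨-((b : Pol k) * wU p (a+1) (b-1) c d), neg_mem (nat_wU p (by omega)), ?_⟩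
  rw [sub_neg_eq_add]
  exact (fam_wU p).r0 a b c d
lemma pres1 : D e1 ∈ Pres (k := k) p := fun x hx => by
  refine U_closed p _ (D_X_hom _) (fun x h => D_mem_pp p _ h) ?_ hx
  intro a b c d hs
  exact ⟨_, (nat_wU p (by omega)), (fam_wU p).r1 a b c d⟩
lemma pres2 : D e2 ∈ Pres (k := k) p := fun x hx => by
  refine U_closed p _ (D_X_hom _) (fun x h => D_mem_pp p _ h) ?_ hx
  intro a b c d hs
  refine ⟨-((d : Pol k) * wU p a b (c+1) (d-1)), neg_mem (nat_wU p (by omega)), ?_⟩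
  rw [sub_neg_eq_add]
  exact (fam_wU p).r2 a b c d
lemma pres3 : D e3 ∈ Pres (k := k) p := fun x hx => by
  refine U_closed p _ (D_X_hom _) (fun x h => D_mem_pp p _ h) ?_ hx
  intro a b c d hs
  exact ⟨_, (nat_wU p (by omega)), (fam_wU p).r3 a b c d⟩
lemma pres5 : Dsh e1 e2 ∈ Pres (k := k) p := fun x hx => by
  refine U_closed p _ (Dsh_X_hom _ _) (fun x h => Dsh_mem_pp p _ _ h) ?_ hx
  intro a b c d hs
  exact ⟨_, sub_mem (nat_wU p (by omega)) (nat_wU p (by omega)), (fam_wU p).r5 a b c d⟩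

lemma be_add (u w : Fin 4 → k) (j : Fin 4) : be (u + w) j = be u j + be w j := by
  fin_cases j <;> simp [be] <;> ring
lemma be_smul (c : k) (w : Fin 4 → k) (j : Fin 4) : be (c • w) j = c * be w j := by
  fin_cases j <;> simp [be]

lemma Dsh_X (u w : Fin 4 → k) (j : Fin 4) :
    Dsh u w (X j) = C (be u j) * lf w + C (be w j) * lf u := by
  simp only [Dsh, Derivation.sub_apply, D_X, be_add, lf_add, C_add]; ring

lemma comm_D (u w : Fin 4 → k) (x : Pol k) :
    D u (D w x) - D w (D u x) = C (B w u) * Dsh u w x := by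
  have : ⁅D u, D w⁆ = (B w u) • Dsh u w := by
    apply MvPolynomial.derivation_ext
    intro j
    rw [Derivation.commutator_apply, D_X, D_X, D_Cmul, D_Cmul, D_lf, D_lf, Derivation.smul_apply,
      Dsh_X, B_swap u w, smul_eq_C_mul]
    simp only [C_neg]; ring
  have h := congrArg (fun δ => δ x) this
  simp only [Derivation.commutator_apply, Derivation.smul_apply, smul_eq_C_mul] at h
  exact h

variable {p}
lemma pres_comm {u w : Fin 4 → k} (hu : D u ∈ Pres p) (hw : D w ∈ Pres p) (h : B w u ≠ 0) :
    Dsh u w ∈ Pres (k := k) p := by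
  intro x hx
  have h1 := Submodule.sub_mem _ (hu _ (hw _ hx)) (hw _ (hu _ hx))
  rw [comm_D, ← smul_eq_C_mul] at h1
  exact ((U k p).smul_mem_iff h).1 h1

lemma Dsh_add_left (u v w : Fin 4 → k) : Dsh (u + v) w = Dsh u w + Dsh v w := by
  apply MvPolynomial.derivation_ext
  intro j
  rw [Derivation.add_apply, Dsh_X, Dsh_X, Dsh_X, be_add, lf_add]; simp only [C_add]; ring
lemma Dsh_comm (u w : Fin 4 → k) : Dsh u w = Dsh w u := by
  apply MvPolynomial.derivation_ext
  intro j
  rw [Dsh_X, Dsh_X]; ring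
lemma pres_add {u w : Fin 4 → k} (hu : D u ∈ Pres p) (hw : D w ∈ Pres p) (h : Dsh u w ∈ Pres p) :
    D (u + w) ∈ Pres (k := k) p := by
  have : D (u + w) = Dsh u w + D u + D w := by rw [Dsh]; abel
  rw [this]; exact add_mem (add_mem h hu) hw

lemma pres_all (u : Fin 4 → k) : D u ∈ Pres (k := k) p := by
  have h01 : Dsh e0 e1 ∈ Pres (k := k) p := pres_comm (pres0 p) (pres1 p) (by simp [B, e0, e1])
  have h23 : Dsh e2 e3 ∈ Pres (k := k) p := pres_comm (pres2 p) (pres3 p) (by simp [B, e2, e3])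
  have h12 := pres_add (pres1 (k := k) p) (pres2 p) (pres5 p)
  have h13 : Dsh e1 e3 ∈ Pres (k := k) p := by
    have := pres_comm h12 (pres3 p) (by simp [B, e1, e2, e3])
    rw [Dsh_add_left] at this
    simpa using sub_mem this h23
  have h02 : Dsh e0 e2 ∈ Pres (k := k) p := by
    have := pres_comm h12 (pres0 p) (by simp [B, e1, e2, e0])
    rw [Dsh_add_left, Dsh_comm e1 e0, Dsh_comm e2 e0] at this
    simpa using sub_mem this h01
  have h13' := pres_add (pres1 (k := k) p) (pres3 p) h13
  have h03 : Dsh e0 e3 ∈ Pres (k := k) p := by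
    have := pres_comm h13' (pres0 p) (by simp [B, e1, e3, e0])
    rw [Dsh_add_left, Dsh_comm e1 e0, Dsh_comm e3 e0] at this
    simpa using sub_mem this h01
  have : D u = (u 0)^2 • D e0 + (u 1)^2 • D e1 + (u 2)^2 • D e2 + (u 3)^2 • D e3
      + (u 0 * u 1) • Dsh e0 e1 + (u 0 * u 2) • Dsh e0 e2 + (u 0 * u 3) • Dsh e0 e3
      + (u 1 * u 2) • Dsh e1 e2 + (u 1 * u 3) • Dsh e1 e3 + (u 2 * u 3) • Dsh e2 e3 := by
    apply MvPolynomial.derivation_ext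
    intro j
    simp only [Derivation.add_apply, Derivation.smul_apply, Dsh_X, D_X, smul_eq_C_mul]
    fin_cases j <;> simp [be, e0, e1, e2, e3, lf, Fin.sum_univ_four] <;> ring
  rw [this]
  refine add_mem (add_mem (add_mem (add_mem (add_mem (add_mem (add_mem (add_mem (add_mem ?_ ?_) ?_) ?_) ?_) ?_) ?_) ?_) ?_) ?_ <;>
    refine Submodule.smul_mem _ _ ?_
  exacts [pres0 p, pres1 p, pres2 p, pres3 p, h01, h02, h03, pres5 p, h13, h23]

lemma D_U (u : Fin 4 → k) {x : Pol k} (hx : x ∈ U k p) : D u x ∈ U k p := pres_all u x hx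

lemma Tv_U (u : Fin 4 → k) (r : k) {x : Pol k} (hx : x ∈ U k p) : Tv u r x ∈ U k p := by
  have h : ex p u r x ∈ U k p := by
    refine Submodule.sum_mem _ fun n hn => ?_
    rw [← smul_eq_C_mul]
    refine Submodule.smul_mem _ _ ?_
    clear hn
    induction n with
    | zero => exact hx
    | succ n ih => rw [Function.iterate_succ_apply']; exact D_U u ih
  have := (U k p).add_mem (pp_U p (Tv_sub_ex p u r x)
    (Submodule.sub_mem _ (Tv_hom u r (U_hom p hx)) (U_hom p h))) h
  rwa [sub_add_cancel] at this

end Usec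
end W3



namespace W3
open MvPolynomial

section Usec2
variable {k : Type} [Field k]
variable {p : ℕ} [Fact p.Prime] [CharP k p]

lemma U_sup {x : Pol k} (hx : x ∈ hom k (2*p-2)) (h : x ∈ U k p ⊔ (pp k p).restrictScalars k) :
    x ∈ U k p := by
  obtain ⟨y, hy, z, hz, rfl⟩ := Submodule.mem_sup.1 h
  refine Submodule.add_mem _ hy (pp_U p hz ?_)
  have := Submodule.sub_mem _ hx (U_hom p hy)
  rwa [add_sub_cancel_left] at this

lemma clo_U : Clo p (U k p ⊔ (pp k p).restrictScalars k) := by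
  have key : ∀ δ : Derivation k (Pol k) (Pol k), (∀ x ∈ U k p, δ x ∈ U k p) →
      (∀ x ∈ pp k p, δ x ∈ pp k p) → ∀ x ∈ U k p ⊔ (pp k p).restrictScalars k,
      δ x ∈ U k p ⊔ (pp k p).restrictScalars k := by
    intro δ h1 h2 x hx
    obtain ⟨y, hy, z, hz, rfl⟩ := Submodule.mem_sup.1 hx
    rw [map_add]
    exact Submodule.mem_sup.2 ⟨_, h1 y hy, _, h2 z hz, rfl⟩
  exact ⟨fun x hx => Submodule.mem_sup_right hx,
    key _ (fun x => D_U _) (fun x => D_mem_pp p _),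
    key _ (fun x => D_U _) (fun x => D_mem_pp p _),
    key _ (fun x => D_U _) (fun x => D_mem_pp p _),
    key _ (fun x => D_U _) (fun x => D_mem_pp p _),
    key _ (fun x => pres5 p x) (fun x => Dsh_mem_pp p _ _)⟩

lemma mon_U (hp : 3 ≤ p) (hodd : Odd p) {a b c d : ℕ} (h1 : a + b = p - 1) (h2 : c + d = p - 1) :
    (mon a b c d : Pol k) ∈ U k p := by
  have h0 : (mon 0 (p-1) 0 (p-1) : Pol k) ∈ U k p := by
    have := wU_U (k := k) p (a := 0) (b := p-1) (c := 0) (d := p-1) (by omega)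
    have hev : Even (p-1 + (p-1)) := ⟨_, rfl⟩
    rw [wU_red p (by omega), dmon, kap, wilson_k, hev.neg_one_pow] at this
    simp at this
    rw [← two_mul] at this
    exact mem_of_nat_mul (n := 2) (p := p) (by omega) (by omega) (by simpa using this)
  refine U_sup (mon_hom' (by omega)) ?_
  refine all_of_one clo_U (fam_mon p) (Submodule.mem_sup_left h0) ?_ ?_ ?_ ?_ a b c d ?_ ?_ <;> omega

def PP (p : ℕ) (f g : Fin 4 → k) : Pol k := lf f ^ (p-1) * lf g ^ (p-1)

lemma pow_hom {n : ℕ} (m : ℕ) {x : Pol k} (h : x ∈ hom k n) : x ^ m ∈ hom k (n * m) :=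
  IsHomogeneous.pow h m

lemma PP_hom (f g : Fin 4 → k) : PP p f g ∈ hom k (2*p-2) := by
  have := IsHomogeneous.mul (pow_hom (p-1) (lf_hom f)) (pow_hom (p-1) (lf_hom g))
  rwa [show 1 * (p-1) + 1 * (p-1) = 2*p-2 by omega] at this

lemma PP_Tv (u f g : Fin 4 → k) (r : k) :
    Tv u r (PP p f g) = PP p (f + (r * B f u) • u) (g + (r * B g u) • u) := by
  simp only [PP, map_mul, map_pow, Tv_lf]

lemma Tv_back (u f : Fin 4 → k) (r : k) :
    (f + (r * B f u) • u) + ((-r) * B (f + (r * B f u) • u) u) • u = f := by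
  rw [B_add_left, B_smul_left, B_self]
  simp

lemma PP_move (u f g : Fin 4 → k) (r : k)
    (h : PP p (f + (r * B f u) • u) (g + (r * B g u) • u) ∈ U k p) : PP p f g ∈ U k p := by
  have := Tv_U u (-r) h
  rwa [PP_Tv, Tv_back, Tv_back] at this

lemma B_Tv (u f g : Fin 4 → k) (r : k) : B (f + (r * B f u) • u) (g + (r * B g u) • u) = B f g := by
  simp [B]; ring

lemma PP_base (hp : 3 ≤ p) (hodd : Odd p) (g : Fin 4 → k) (h : B e0 g = 0) : PP p e0 g ∈ U k p := by
  have hg1 : g 1 = 0 := by simpa [B, e0] using h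
  have hl : lf g = C (g 2) * X 2 + C (g 3) * X 3 + C (g 0) * X 0 := by
    simp [lf, Fin.sum_univ_four, hg1]; ring
  have hl0 : lf (e0 : Fin 4 → k) = X 0 := by simp [lf, Fin.sum_univ_four, e0]
  have h1 : (X 0 : Pol k)^(p-1) * (C (g 2) * X 2 + C (g 3) * X 3)^(p-1) ∈ U k p := by
    rw [add_pow, Finset.mul_sum]
    refine Submodule.sum_mem _ fun m hm => ?_
    have hm' : m < p := by
      have := Finset.mem_range.1 hm; omega
    have : (X 0 : Pol k)^(p-1) * ((C (g 2) * X 2)^m * (C (g 3) * X 3)^(p-1-m) * (((p-1).choose m : ℕ) : Pol k))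
        = (g 2 ^ m * g 3 ^ (p-1-m) * (((p-1).choose m : ℕ) : k)) • mon (p-1) 0 m (p-1-m) := by
      rw [smul_eq_C_mul, castP]; simp only [mon, C_mul, mul_pow, C_pow]; ring
    rw [this]
    exact Submodule.smul_mem _ _ (mon_U hp hodd (by omega) (by omega))
  have h1h := U_hom p h1
  have h2 : PP p e0 g - (X 0 : Pol k)^(p-1) * (C (g 2) * X 2 + C (g 3) * X 3)^(p-1) ∈ pp k p := by
    rw [PP, hl0, ← mul_sub]
    have hd : lf g - (C (g 2) * X 2 + C (g 3) * X 3) ∣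
      lf g ^ (p-1) - (C (g 2) * X 2 + C (g 3) * X 3)^(p-1) := sub_dvd_pow_sub_pow _ _ _
    obtain ⟨q, hq⟩ := hd
    rw [hq, hl, add_sub_cancel_left]
    have : (X 0 : Pol k) ^ (p-1) * (C (g 0) * X 0 * q) = (C (g 0) * q) * X 0 ^ p := by
      have e : (X 0 : Pol k) ^ p = X 0 ^ (p-1) * X 0 := by
        rw [← pow_succ, show p - 1 + 1 = p by omega]
      rw [e]; ring
    rw [this]
    exact Ideal.mul_mem_left _ _ (X_pow_mem_pp p 0)
  have := Submodule.add_mem _ (pp_U p h2 (Submodule.sub_mem _ (PP_hom _ _) h1h)) h1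
  rwa [sub_add_cancel] at this

lemma PP_step (hp : 3 ≤ p) (h : Fin 4 → k) (hh : ∀ g, B h g = 0 → PP p h g ∈ U k p)
    (f g : Fin 4 → k) (hfh : B f h ≠ 0) (hfg : B f g = 0) : PP p f g ∈ U k p := by
  set r := (B f h)⁻¹ with hr
  have e : f + (r * B f (h - f)) • (h - f) = h := by
    have : B f (h - f) = B f h := by simp [B]; ring
    rw [this, inv_mul_cancel₀ hfh, one_smul, add_sub_cancel]
  refine PP_move (h - f) f g r ?_
  have hB := B_Tv (h - f) f g r
  rw [e] at hB ⊢
  exact hh _ (hB.trans hfg)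

lemma PP_U (hp : 3 ≤ p) (hodd : Odd p) (f g : Fin 4 → k) (hfg : B f g = 0) : PP p f g ∈ U k p := by
  have s1 : ∀ f : Fin 4 → k, f 1 ≠ 0 → ∀ g, B f g = 0 → PP p f g ∈ U k p := by
    intro f h1 g
    refine PP_step hp e0 (PP_base hp hodd) f g ?_
    simpa [B, e0] using h1
  by_cases h0 : f 0 = 0
  swap
  · exact PP_step hp e1 (s1 e1 (by simp [e1])) f g (by simpa [B, e1] using h0) hfg
  by_cases h1 : f 1 = 0
  swap
  · exact s1 f h1 g hfg
  by_cases h2 : f 2 = 0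
  swap
  · exact PP_step hp (e1 + e3) (s1 _ (by simp [e1, e3])) f g (by simpa [B, e1, e3, h0] using h2) hfg
  by_cases h3 : f 3 = 0
  swap
  · exact PP_step hp (e1 + e2) (s1 _ (by simp [e1, e2])) f g (by simpa [B, e1, e2, h0] using h3) hfg
  have : lf f = 0 := by simp [lf, Fin.sum_univ_four, h0, h1, h2, h3]
  rw [PP, this, zero_pow (by omega), zero_mul]
  exact Submodule.zero_mem _

end Usec2
end W3



namespace W3
open MvPolynomial

section levels
variable {k : Type} [Field k] [Fintype k]
variable {p : ℕ} [Fact p.Prime] [CharP k p] {t : ℕ} [NeZero t]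

abbrev Fn (k : Type) [Field k] : Type := (Fin 4 → k) → k

/-- evaluation at Frobenius twist level `i` -/
def evF (k : Type) [Field k] (p i : ℕ) : Pol k →ₐ[k] Fn k := aeval (fun j v => v j ^ p ^ i)

lemma evF_X (i : ℕ) (j : Fin 4) (v : Fin 4 → k) : evF k p i (X j) v = v j ^ p ^ i := by
  simp [evF]

lemma evF_C (i : ℕ) (c : k) (v : Fin 4 → k) : evF k p i (C c) v = c := by
  rw [evF, algHom_C]; rfl

lemma frob_step (hq : Fintype.card k = p ^ t) (i : Fin t) (x : k) :
    (x ^ p ^ (i : ℕ)) ^ p = x ^ p ^ ((i + 1 : Fin t) : ℕ) := by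
  rw [← pow_mul, ← pow_succ]
  by_cases h : (i : ℕ) + 1 < t
  · rw [Fin.val_add_one_of_lt' h]
  · have h1 : (i : ℕ) + 1 = t := by have := i.2; omega
    have h2 : ((i + 1 : Fin t) : ℕ) = 0 := by
      rw [Fin.val_add, Fin.val_one', Nat.add_mod_mod, h1, Nat.mod_self]
    rw [h1, h2, ← hq, FiniteField.pow_card]; simp

variable (k p t) in
def L : MultilinearMap k (fun _ : Fin t => Pol k) (Fn k) :=
  (MultilinearMap.mkPiAlgebra k (Fin t) (Fn k)).compLinearMap (fun i => (evF k p i).toLinearMap)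

lemma Lap_apply (F : Fin t → Pol k) : L k p t F = ∏ i : Fin t, evF k p i (F i) := by
  simp [L]

lemma L_update_mul (F : Fin t → Pol k) (i : Fin t) (x y : Pol k) :
    L k p t (Function.update F i (x * y)) = evF k p i x * L k p t (Function.update F i y) := by
  rw [Lap_apply, Lap_apply, ← Finset.mul_prod_erase _ _ (Finset.mem_univ i),
    ← Finset.mul_prod_erase _ _ (Finset.mem_univ i)]
  simp only [Function.update_self, map_mul, mul_assoc]
  congr 2
  refine Finset.prod_congr rfl fun j hj => ?_
  rw [Function.update_of_ne (Finset.ne_of_mem_erase hj), Function.update_of_ne (Finset.ne_of_mem_erase hj)]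

lemma evF_pow (hq : Fintype.card k = p ^ t) (i : Fin t) (j : Fin 4) :
    evF k p i (X j ^ p) = evF k p ((i + 1 : Fin t) : ℕ) (X j) := by
  funext v
  rw [map_pow, Pi.pow_apply, evF_X, evF_X, frob_step hq]

/-- dot product -/
def dt (f v : Fin 4 → k) : k := ∑ j, f j * v j

variable (k) in
def gn (q : ℕ) (f g : Fin 4 → k) : Fn k := fun v => dt f v ^ (q-1) * dt g v ^ (q-1)

variable (k) in
def C0 (q : ℕ) : Submodule k (Fn k) :=
  Submodule.span k {x | ∃ f g, B f g = 0 ∧ x = gn k q f g}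

lemma evF_lf (i : ℕ) (f v : Fin 4 → k) : evF k p i (lf (fun j => f j ^ p ^ i)) v = dt f v ^ p ^ i := by
  have : evF k p i (lf (fun j => f j ^ p ^ i)) v = ∑ j, evF k p i (C (f j ^ p ^ i)) v * evF k p i (X j) v := by
    simp only [lf, map_sum, map_mul, Finset.sum_apply, Pi.mul_apply]
  rw [this, dt, sum_pow_char_pow]
  simp only [evF_C, evF_X, mul_pow]

lemma sum_pow_digits : ∑ i : Fin t, p ^ (i : ℕ) * (p - 1) = p ^ t - 1 := by
  rw [Fin.sum_univ_eq_sum_range (fun i => p ^ i * (p-1)), ← Finset.sum_mul]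
  have h2 := (Fact.out : p.Prime).two_le
  exact Nat.geomSum_eq h2 t ▸ Nat.div_mul_cancel (Nat.sub_one_dvd_pow_sub_one p t)

lemma gn_eq_L (f g : Fin 4 → k) :
    gn k (p ^ t) f g = L k p t (fun i => PP p (fun j => f j ^ p ^ (i:ℕ)) (fun j => g j ^ p ^ (i:ℕ))) := by
  funext v
  rw [Lap_apply, Finset.prod_apply]
  simp only [PP, map_mul, map_pow, Pi.mul_apply, Pi.pow_apply, evF_lf, ← pow_mul,
    Finset.prod_mul_distrib, Finset.prod_pow_eq_pow_sum, sum_pow_digits]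
  rfl

lemma extract (hq : Fintype.card k = p ^ t) {W : Type} [AddCommGroup W] [Module k W] (S : Submodule k W)
    (c : (Fin t → Fin p) → W)
    (h : ∀ r : k, ∑ n, (r ^ (∑ i : Fin t, (n i : ℕ) * p ^ (i : ℕ))) • c n ∈ S) (n : Fin t → Fin p) : c n ∈ S := by
  by_contra hn
  obtain ⟨φ, h1, h2⟩ := Submodule.exists_le_ker_of_notMem hn
  let P : Polynomial k := ∑ n, Polynomial.monomial (finFunctionFinEquiv n : ℕ) (φ (c n))
  have hdeg : P.degree < (p^t : ℕ) := by
    refine lt_of_le_of_lt (Polynomial.degree_sum_le _ _) ?_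
    rw [Finset.sup_lt_iff (WithBot.bot_lt_coe _)]
    intro m _
    refine lt_of_le_of_lt (Polynomial.degree_monomial_le _ _) ?_
    exact_mod_cast (finFunctionFinEquiv m).2
  have hP : P = 0 := by
    refine Polynomial.eq_zero_of_degree_lt_of_eval_finset_eq_zero (s := Finset.univ) ?_ ?_
    · rw [Finset.card_univ, hq]; exact hdeg
    · intro r _
      have := h2 (h r)
      rw [LinearMap.mem_ker, map_sum] at this
      rw [Polynomial.eval_finset_sum, ← this]
      refine Finset.sum_congr rfl fun m _ => ?_
      rw [Polynomial.eval_monomial, map_smul, smul_eq_mul, finFunctionFinEquiv_apply, mul_comm]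
  apply h1
  have : P.coeff (finFunctionFinEquiv n : ℕ) = φ (c n) := by
    simp only [P, Polynomial.finset_sum_coeff, Polynomial.coeff_monomial]
    rw [Finset.sum_eq_single n]
    · simp
    · intro b _ hb
      rw [if_neg]
      intro h
      exact hb (finFunctionFinEquiv.injective (Fin.ext h))
    · simp
  rw [← this, hP]; simp

lemma extractL (hq : Fintype.card k = p ^ t) (S : Submodule k (Fn k)) (G : Fin t → Fin p → Pol k)
    (h : ∀ r : k, L k p t (fun i => ∑ n : Fin p, ((r ^ p ^ (i : ℕ)) ^ (n : ℕ)) • G i n) ∈ S)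
    (n : Fin t → Fin p) : L k p t (fun i => G i (n i)) ∈ S := by
  refine extract hq S (fun n => L k p t (fun i => G i (n i))) ?_ n
  intro r
  have := h r
  rw [MultilinearMap.map_sum] at this
  convert this using 2
  rename_i m _
  rw [MultilinearMap.map_smul_univ]
  congr 1
  rw [← Finset.prod_pow_eq_pow_sum]
  refine Finset.prod_congr rfl fun i _ => ?_
  rw [← pow_mul, mul_comm]

lemma evF_comp (i : ℕ) (T : (Fin 4 → k) → (Fin 4 → k)) (τ : Pol k →ₐ[k] Pol k)
    (h : ∀ j v, evF k p i (τ (X j)) v = (T v j) ^ p ^ i) (x : Pol k) (v : Fin 4 → k) :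
    evF k p i (τ x) v = evF k p i x (T v) := by
  induction x using MvPolynomial.induction_on with
  | C a => rw [algHom_C, algebraMap_eq, evF_C, evF_C]
  | add x y hx hy => simp only [map_add, Pi.add_apply, hx, hy]
  | mul_X x j hx => simp only [map_mul, Pi.mul_apply, hx, h, evF_X]

lemma subst_C0 (q : ℕ) (T S : (Fin 4 → k) → (Fin 4 → k)) (hS : ∀ f v, dt f (T v) = dt (S f) v)
    (hB : ∀ f g, B (S f) (S g) = B f g) (τ : Fin t → Pol k →ₐ[k] Pol k)
    (h : ∀ (i : Fin t) j v, evF k p i (τ i (X j)) v = (T v j) ^ p ^ (i : ℕ)) {F : Fin t → Pol k}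
    (hF : L k p t F ∈ C0 k q) : L k p t (fun i => τ i (F i)) ∈ C0 k q := by
  have h1 : L k p t (fun i => τ i (F i)) = LinearMap.funLeft k k T (L k p t F) := by
    funext v
    rw [LinearMap.funLeft_apply, Lap_apply, Lap_apply, Finset.prod_apply, Finset.prod_apply]
    exact Finset.prod_congr rfl fun i _ => evF_comp _ T _ (h i) _ _
  rw [h1]
  have : C0 k q ≤ (C0 k q).comap (LinearMap.funLeft k k T) := by
    rw [C0, Submodule.span_le]
    rintro _ ⟨f, g, hfg, rfl⟩
    refine Submodule.subset_span ⟨S f, S g, (hB f g).trans hfg, ?_⟩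
    funext v
    simp only [LinearMap.funLeft_apply, gn, hS]
  exact this hF

lemma Tv_C0 (q : ℕ) (u : Fin 4 → k) (hu : ∀ j, u j ^ p = u j) (r : k) {F : Fin t → Pol k}
    (hF : L k p t F ∈ C0 k q) : L k p t (fun i => Tv u (r ^ p ^ (i : ℕ)) (F i)) ∈ C0 k q := by
  have hu' : ∀ (i : ℕ) j, u j ^ p ^ i = u j := by
    intro i j
    induction i with
    | zero => simp
    | succ i ih => rw [pow_succ, pow_mul, ih, hu]
  have hbe : ∀ (i : ℕ) j, be u j ^ p ^ i = be u j := by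
    intro i j
    have hn : ∀ x : k, (-x) ^ p ^ i = -(x ^ p ^ i) := by
      intro x
      have := map_neg (iterateFrobenius k p i) x
      simpa [iterateFrobenius_def] using this
    fin_cases j <;> simp [be, hn, hu']
  refine subst_C0 q (fun v => v + (r * dt u v) • be u) (fun f => f + (r * B f u) • u) ?_ ?_ _ ?_ hF
  · intro f v
    rw [B_eq]
    simp only [dt, Fin.sum_univ_four, Pi.add_apply, Pi.smul_apply, smul_eq_mul]; ring
  · intro f g; exact B_Tv u f g r
  · intro i j v
    rw [Tv, aeval_X, map_add, map_mul]
    simp only [Pi.add_apply, Pi.mul_apply, evF_X, evF_C, Pi.smul_apply, smul_eq_mul]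
    have h1 : lf u = lf (fun j => u j ^ p ^ (i:ℕ)) := by simp only [hu']
    rw [h1, evF_lf, add_pow_char_pow, mul_pow, mul_pow, hbe]; ring

end levels
end W3



namespace W3
open MvPolynomial

section levels2
variable {k : Type} [Field k]
variable {p : ℕ}

lemma homc_mul (c : Pol k) {y : Pol k} {m : ℕ} (hy : y ∈ hom k m) (n : ℕ) :
    homogeneousComponent n (c * y) = if m ≤ n then homogeneousComponent (n - m) c * y else 0 := by
  conv_lhs => rw [← sum_homogeneousComponent c, Finset.sum_mul, map_sum]
  have h1 : ∀ l, homogeneousComponent n (homogeneousComponent l c * y) =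
      if n = l + m then homogeneousComponent l c * y else 0 := by
    intro l
    exact homogeneousComponent_of_mem ((homogeneousComponent_isHomogeneous l c).mul hy)
  simp only [h1]
  split_ifs with h
  · rw [Finset.sum_eq_single (n - m)]
    · rw [if_pos (by omega)]
    · intro b _ hb
      rw [if_neg (by omega)]
    · intro hn
      rw [Finset.mem_range, not_lt] at hn
      rw [homogeneousComponent_eq_zero _ _ (by omega)]; simp
  · refine Finset.sum_eq_zero fun l _ => ?_
    rw [if_neg (by omega)]

lemma pp_decomp {x : Pol k} {n : ℕ} (h : x ∈ pp k p) (hx : x ∈ hom k n) :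
    (n < p → x = 0) ∧ ∃ b : Fin 4 → Pol k, (∀ j, b j ∈ hom k (n - p)) ∧
      x = ∑ j, X j ^ p * b j := by
  obtain ⟨c, hc⟩ := Ideal.mem_span_range_iff_exists_fun.1 h
  have hX : ∀ j : Fin 4, (X j : Pol k) ^ p ∈ hom k p := fun j => by
    simpa using (isHomogeneous_X k j).pow p
  have h1 : x = ∑ j, homogeneousComponent n (c j * X j ^ p) := by
    rw [← map_sum, hc, homogeneousComponent_of_mem hx, if_pos rfl]
  simp only [fun j => homc_mul (c j) (hX j) n] at h1
  constructor
  · intro hn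
    rw [h1]
    exact Finset.sum_eq_zero fun j _ => if_neg (by omega)
  · by_cases hn : p ≤ n
    · refine ⟨fun j => homogeneousComponent (n - p) (c j),
        fun j => homogeneousComponent_isHomogeneous _ _, ?_⟩
      rw [h1]
      exact Finset.sum_congr rfl fun j _ => by rw [if_pos hn, mul_comm]
    · refine ⟨fun j => 0, fun j => Submodule.zero_mem _, ?_⟩
      rw [h1]
      simp [hn]

def dg (p : ℕ) : Bool → Bool → ℕ
  | false, false => 2*p-2
  | true, false => 2*p-1
  | false, true => p-2
  | true, true => p-1

variable (k) in
def Sub (p : ℕ) (a b : Bool) : Submodule k (Pol k) :=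
  if a = false ∧ b = false then U k p else hom k (dg p a b)

lemma Sub_t (a : Bool) : Sub k p a true = hom k (dg p a true) := by simp [Sub]
lemma Sub_t' (a : Bool) : Sub k p true a = hom k (dg p true a) := by simp [Sub]
lemma Sub_ff : Sub k p false false = U k p := by simp [Sub]

variable [Fact p.Prime] [CharP k p]

lemma Sub_hom {a b : Bool} {x : Pol k} (h : x ∈ Sub k p a b) : x ∈ hom k (dg p a b) := by
  unfold Sub at h
  split_ifs at h with h1
  · rw [h1.1, h1.2]; exact U_hom p h
  · exact h

lemma pp_Sub {a b : Bool} {x : Pol k} (h : x ∈ pp k p) (h' : x ∈ hom k (dg p a b)) :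
    x ∈ Sub k p a b := by
  unfold Sub
  split_ifs with h1
  · rw [h1.1, h1.2] at h'; exact pp_U p h h'
  · exact h'

lemma Sub_mulX {b : Bool} {x : Pol k} (h : x ∈ Sub k p false b) (j : Fin 4) :
    X j * x ∈ Sub k p true b := by
  rw [Sub_t']
  have h1 := IsHomogeneous.mul (isHomogeneous_X k j) (Sub_hom h)
  have := (Fact.out : p.Prime).two_le
  have h2 : 1 + dg p false b = dg p true b := by
    cases b <;> simp [dg] <;> omega
  rwa [h2] at h1

lemma D_Sub (u : Fin 4 → k) {a b : Bool} {x : Pol k} (h : x ∈ Sub k p a b) :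
    D u x ∈ Sub k p a b := by
  unfold Sub at h ⊢
  split_ifs at h ⊢
  · exact D_U u h
  · exact D_hom u h

lemma Tv_Sub (u : Fin 4 → k) (r : k) {a b : Bool} {x : Pol k} (h : x ∈ Sub k p a b) :
    Tv u r x ∈ Sub k p a b := by
  unfold Sub at h ⊢
  split_ifs at h ⊢
  · exact Tv_U u r h
  · exact Tv_hom u r h

lemma Dit_Sub (u : Fin 4 → k) {a b : Bool} {x : Pol k} (h : x ∈ Sub k p a b) (n : ℕ) :
    (D u)^[n] x ∈ Sub k p a b := by
  induction n with
  | zero => exact h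
  | succ n ih => rw [Function.iterate_succ_apply']; exact D_Sub u ih

lemma ex_Sub (u : Fin 4 → k) (r : k) {a b : Bool} {x : Pol k} (h : x ∈ Sub k p a b) :
    ex p u r x ∈ Sub k p a b := by
  refine Submodule.sum_mem _ fun n _ => ?_
  rw [← smul_eq_C_mul]
  exact Submodule.smul_mem _ _ (Dit_Sub u h n)

variable [Fintype k] {t : ℕ} [NeZero t]

/-- admissible tuples -/
def Adm (p : ℕ) (s : Fin t → Bool) (F : Fin t → Pol k) : Prop := ∀ i, F i ∈ Sub k p (s i) (s (i+1))

variable (k p) in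
def NN (s : Fin t → Bool) : Submodule k (Fn k) :=
  Submodule.span k {x | ∃ F, Adm p s F ∧ x = L k p t F}

variable (k p) in
def Ngt (s : Fin t → Bool) : Submodule k (Fn k) := ⨆ s' : {s' // s < s'}, NN k p s'.1

lemma adm_update {s : Fin t → Bool} {F : Fin t → Pol k} (h : Adm p s F) (i : Fin t) {x : Pol k}
    (hx : x ∈ Sub k p (s i) (s (i+1))) : Adm p s (Function.update F i x) := by
  intro l
  by_cases hl : l = i
  · subst hl; simpa using hx
  · rw [Function.update_of_ne hl]; exact h l

lemma carry (hq : Fintype.card k = p ^ t) {s : Fin t → Bool} {F : Fin t → Pol k} (h : Adm p s F)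
    (i : Fin t) (hi : F i ∈ pp k p) : L k p t F ∈ Ngt k p s := by
  have hp2 := (Fact.out : p.Prime).two_le
  have hFi := Sub_hom (h i)
  obtain ⟨h0, b, hb, hFb⟩ := pp_decomp hi hFi
  by_cases hs : s (i+1) = true
  · have : F i = 0 := h0 (by rw [hs]; cases s i <;> simp [dg] <;> omega)
    rw [(L k p t).map_coord_zero i this]; exact Submodule.zero_mem _
  · have hs : s (i+1) = false := by simpa using hs
    have hdg : dg p (s i) (s (i+1)) - p = dg p (s i) true := by
      rw [hs]; cases s i <;> simp [dg] <;> omega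
    rw [hdg] at hb
    set s' := Function.update s (i+1) true with hs'
    have hlt : s < s' := by
      rw [hs', lt_update_self_iff, hs]; decide
    have e1 : F = Function.update F i (F i) := by simp
    rw [e1, hFb, (L k p t).map_update_sum]
    refine Submodule.sum_mem _ fun j _ => ?_
    rw [L_update_mul, evF_pow hq]
    set F' := Function.update F i (b j) with hF'
    have hF's : ∀ l, F' l ∈ Sub k p (s l) (s' (l+1)) := by
      intro l
      by_cases hl : l = i
      · subst hl
        rw [hF', Function.update_self, hs', Function.update_self, Sub_t]
        exact hb j
      · rw [hF', Function.update_of_ne hl, hs', Function.update_of_ne (by simpa using hl)]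
        exact h l
    have e2 : F' = Function.update F' (i+1) (F' (i+1)) := by simp
    rw [e2, ← L_update_mul]
    refine Submodule.mem_iSup_of_mem ⟨s', hlt⟩ (Submodule.subset_span ⟨_, ?_, rfl⟩)
    intro l
    by_cases hl : l = i + 1
    · rw [hl, Function.update_self]
      have : s' (i+1) = true := by simp [hs']
      simp only [this]
      refine Sub_mulX ?_ j
      rw [← hs]; exact hF's (i+1)
    · rw [Function.update_of_ne hl]
      have : s' l = s l := by rw [hs', Function.update_of_ne hl]
      simp only [this]
      exact hF's l

lemma congr_L (hq : Fintype.card k = p ^ t) {s : Fin t → Bool} {F F' : Fin t → Pol k} (h : Adm p s F)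
    (h' : Adm p s F') (hpp : ∀ i, F i - F' i ∈ pp k p) : L k p t F - L k p t F' ∈ Ngt k p s := by
  have key : ∀ T : Finset (Fin t), L k p t F - L k p t (T.piecewise F' F) ∈ Ngt k p s := by
    intro T
    induction T using Finset.induction_on with
    | empty => simp
    | insert a T ha ih =>
      rw [Finset.piecewise_insert]
      set G := T.piecewise F' F with hG
      have hGa : G a = F a := by simp [hG, ha]
      have hadm : Adm p s G := by
        intro l
        by_cases hl : l ∈ T
        · simp [hG, hl]; exact h' l
        · simp [hG, hl]; exact h l
      have e1 : L k p t G - L k p t (Function.update G a (F' a)) ∈ Ngt k p s := by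
        conv in (L k p t) G => rw [show G = Function.update G a (F a) by rw [← hGa]; simp]
        rw [← (L k p t).map_update_sub]
        refine carry hq (adm_update hadm a (Submodule.sub_mem _ (h a) (h' a))) a ?_
        simpa using hpp a
      have := Submodule.add_mem _ ih e1
      rwa [sub_add_sub_cancel] at this
  simpa using key Finset.univ

lemma close_D (hq : Fintype.card k = p ^ t) {s : Fin t → Bool} (hN : Ngt k p s ≤ C0 k (p^t))
    {F : Fin t → Pol k} (h : Adm p s F) (hF : L k p t F ∈ C0 k (p^t)) (u : Fin 4 → k)
    (hu : ∀ j, u j ^ p = u j) (i : Fin t) :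
    L k p t (Function.update F i (D u (F i))) ∈ C0 k (p^t) := by
  have hp2 := (Fact.out : p.Prime).two_le
  have h1 : ∀ r : k, L k p t (fun i => ∑ n : Fin p, ((r ^ p ^ (i : ℕ)) ^ (n : ℕ)) •
      (((n : ℕ).factorial : k)⁻¹ • (D u)^[(n:ℕ)] (F i))) ∈ C0 k (p^t) := by
    intro r
    have a1 := Tv_C0 (p^t) u hu r hF
    have a2 := hN (congr_L hq (s := s) (F := fun i => Tv u (r ^ p ^ (i : ℕ)) (F i))
      (F' := fun i => ex p u (r ^ p ^ (i : ℕ)) (F i)) (fun i => Tv_Sub u _ (h i))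
      (fun i => ex_Sub u _ (h i)) (fun i => Tv_sub_ex p u _ _))
    have a3 := Submodule.sub_mem _ a1 a2
    rw [sub_sub_cancel] at a3
    convert a3 using 3
    rename_i i
    rw [ex, ← Fin.sum_univ_eq_sum_range
      (fun n => C ((r ^ p ^ (i:ℕ)) ^ n * ((n.factorial : k))⁻¹) * (D u)^[n] (F i))]
    refine Finset.sum_congr rfl fun n _ => ?_
    rw [smul_smul, smul_eq_C_mul]
  have h2 := extractL hq _ _ h1 (fun l => if l = i then ⟨1, by omega⟩ else ⟨0, by omega⟩)
  convert h2 using 2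
  funext l
  by_cases hl : l = i
  · subst hl; simp
  · simp [hl]

end levels2
end W3



namespace W3
open MvPolynomial

section levels3
variable {k : Type} [Field k] [Fintype k]
variable {p : ℕ} [Fact p.Prime] [CharP k p] {t : ℕ} [NeZero t]

/-- binomial coefficient vectors -/
def bin (p : ℕ) (x y z : Pol k) (n : ℕ) : Pol k := ((p-1).choose n : k) • (x ^ (p-1-n) * y ^ n * z)

lemma bin_sum (x y z : Pol k) (r : k) :
    (x + C r * y) ^ (p-1) * z = ∑ n : Fin p, (r ^ (n : ℕ)) • bin p x y z n := by
  have hp2 := (Fact.out : p.Prime).two_le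
  rw [Fin.sum_univ_eq_sum_range (fun n => r ^ n • bin p x y z n), add_comm, add_pow,
    show p - 1 + 1 = p by omega, Finset.sum_mul]
  refine Finset.sum_congr rfl fun n _ => ?_
  rw [bin, smul_smul, smul_eq_C_mul, castP, mul_pow]
  simp only [C_mul, C_pow]; ring

lemma bin_zero (x y z : Pol k) : bin p x y z 0 = x ^ (p-1) * z := by simp [bin]
lemma bin_top (x y z : Pol k) : bin p x y z (p-1) = y ^ (p-1) * z := by simp [bin]

lemma start1 (hq : Fintype.card k = p ^ t) (b : Fin t → Bool) :
    L k p t (fun i => (if b i then X 0 ^ (p-1) else X 1 ^ (p-1)) * X 2 ^ (p-1)) ∈ C0 k (p^t) := by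
  have hp2 := (Fact.out : p.Prime).two_le
  have h : ∀ r : k, L k p t (fun i => ∑ n : Fin p, ((r ^ p ^ (i : ℕ)) ^ (n : ℕ)) •
      bin p (X 0) (X 1) (X 2 ^ (p-1)) n) ∈ C0 k (p^t) := by
    intro r
    have h1 : gn k (p^t) ![1, r, 0, 0] ![0,0,1,0] ∈ C0 k (p^t) :=
      Submodule.subset_span ⟨_, _, by simp [B], rfl⟩
    rw [gn_eq_L] at h1
    convert h1 using 3
    rename_i i
    have : p ^ (i:ℕ) ≠ 0 := by positivity
    have h0 : (0:Pol k) ^ p ^ (i:ℕ) = 0 := zero_pow this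
    have h0' : (0:k) ^ p ^ (i:ℕ) = 0 := zero_pow this
    rw [← bin_sum, PP]
    simp [lf, Fin.sum_univ_four, h0, h0']
  have h2 := extractL hq _ _ h (fun i => if b i then ⟨0, by omega⟩ else ⟨p-1, by omega⟩)
  convert h2 using 3
  rename_i i
  cases b i
  · simp [bin_top]
  · simp [bin_zero]

lemma start2 (hq : Fintype.card k = p ^ t) (b : Fin t → Bool) :
    L k p t (fun i => if b i then X 0 ^ (p-1) * X 2 ^ (p-1) else X 1 ^ (p-1) * X 3 ^ (p-1)) ∈ C0 k (p^t) := by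
  have hp2 := (Fact.out : p.Prime).two_le
  have h : ∀ r : k, L k p t (fun i => ∑ n : Fin p, ((r ^ p ^ (i : ℕ)) ^ (n : ℕ)) •
      bin p (X 2) (X 3) (if b i then X 0 ^ (p-1) else X 1 ^ (p-1)) n) ∈ C0 k (p^t) := by
    intro r
    have h1 := Tv_C0 (p^t) e3 (fun j => by
      fin_cases j <;> simp [e3] <;> omega) r (start1 hq b)
    convert h1 using 3
    rename_i i
    rw [← bin_sum, map_mul, map_pow, mul_comm]
    cases b i <;> simp [Tv, be, e3, lf, Fin.sum_univ_four]
  have h2 := extractL hq _ _ h (fun i => if b i then ⟨0, by omega⟩ else ⟨p-1, by omega⟩)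
  convert h2 using 3
  rename_i i
  cases b i
  · simp [bin_top]; ring
  · simp [bin_zero]; ring

/-- short root element -/
def Sh (r : k) : Pol k →ₐ[k] Pol k := aeval ![X 0 + C r * X 2, X 1, X 2, X 3 + C r * (-X 1)]

lemma Sh_C0 (q : ℕ) (r : k) {F : Fin t → Pol k}
    (hF : L k p t F ∈ C0 k q) : L k p t (fun i => Sh (r ^ p ^ (i : ℕ)) (F i)) ∈ C0 k q := by
  refine subst_C0 q (fun v => ![v 0 + r * v 2, v 1, v 2, v 3 - r * v 1])
    (fun f => ![f 0, f 1 - r * f 3, f 2 + r * f 0, f 3]) ?_ ?_ _ ?_ hF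
  · intro f v
    simp [dt, Fin.sum_univ_four]; ring
  · intro f g; simp [B]; ring
  · intro i j v
    fin_cases j
    · simp [Sh, evF_X, evF_C, add_pow_char_pow, mul_pow]
    · simp [Sh, evF_X, evF_C, add_pow_char_pow, mul_pow]
    · simp [Sh, evF_X, evF_C, add_pow_char_pow, mul_pow]
    · simp [Sh, evF_X, evF_C, sub_pow_char_pow, mul_pow]; ring

/-- start vectors -/
def zz (p : ℕ) (s : Fin t → Bool) (i : Fin t) : Pol k :=
  (if s i then X 2 else 1) * (if s (i+1) then X 0 ^ (p-2) else X 1 ^ (p-1) * X 3 ^ (p-1))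

lemma start3 (hq : Fintype.card k = p ^ t) (hp : 3 ≤ p) (s : Fin t → Bool) :
    L k p t (zz p s) ∈ C0 k (p^t) := by
  let Y : Fin t → Fin p → Pol k := fun i n => if s (i+1) then bin p (X 0) (X 2) (X 2 ^ (p-1)) n
    else bin p (X 3) (- X 1) (X 1 ^ (p-1)) n
  have h : ∀ r : k, L k p t (fun i => ∑ n : Fin p, ((r ^ p ^ (i : ℕ)) ^ (n : ℕ)) • Y i n) ∈ C0 k (p^t) := by
    intro r
    have h1 := Sh_C0 (p^t) r (start2 hq (fun i => s (i+1)))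
    convert h1 using 3
    rename_i i
    by_cases hs : s (i+1) = true
    · simp only [Y, hs, if_true]
      rw [← bin_sum, map_mul, map_pow, map_pow]
      simp [Sh]
    · have hs : s (i+1) = false := by simpa using hs
      simp only [Y, hs, Bool.false_eq_true, if_false]
      rw [← bin_sum, map_mul, map_pow, map_pow, mul_comm]
      simp [Sh]
  have h2 := extractL hq _ _ h (fun i => if s (i+1) then ⟨1, by omega⟩ else ⟨0, by omega⟩)
  have h3 : L k p t (fun i => (if s (i+1) then ((p-1 : ℕ) : k) else 1) •
      ((if s (i+1) then X 2 ^ p else 1) * (if s (i+1) then X 0 ^ (p-2) else X 1 ^ (p-1) * X 3 ^ (p-1))))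
      ∈ C0 k (p^t) := by
    convert h2 using 3
    rename_i i
    by_cases hs : s (i+1) = true
    · simp only [Y, hs, if_true, bin, Nat.choose_one_right, pow_one]
      congr 1
      have : (X 2 : Pol k) ^ p = X 2 * X 2 ^ (p-1) := by
        rw [← pow_succ', show p - 1 + 1 = p by omega]
      rw [this, show p - 1 - 1 = p - 2 by omega]; ring
    · have hs : s (i+1) = false := by simpa using hs
      simp only [Y, hs, Bool.false_eq_true, if_false]
      simp [bin_zero]; ring
  rw [MultilinearMap.map_smul_univ] at h3
  have hne : ∏ i : Fin t, (if s (i+1) then ((p-1 : ℕ) : k) else 1) ≠ 0 := by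
    rw [Finset.prod_ne_zero_iff]
    intro i _
    split_ifs
    · exact natCast_ne (p := p) (by omega) (by omega)
    · exact one_ne_zero
  rw [Submodule.smul_mem_iff _ hne] at h3
  convert h3 using 1
  rw [Lap_apply, Lap_apply]
  simp only [zz, map_mul, Finset.prod_mul_distrib]
  congr 1
  rw [← Equiv.prod_comp (Equiv.addRight (1 : Fin t))]
  refine Finset.prod_congr rfl fun i _ => ?_
  simp only [Equiv.coe_addRight]
  by_cases hs : s (i+1) = true
  · simp only [hs, if_true]
    rw [evF_pow hq]
  · simp [hs]

lemma zz_cases (s : Fin t → Bool) (i : Fin t) : (zz p s i : Pol k) =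
    match s i, s (i+1) with
    | false, false => mon 0 (p-1) 0 (p-1)
    | true, false => mon 0 (p-1) 1 (p-1)
    | false, true => mon (p-2) 0 0 0
    | true, true => mon (p-2) 0 1 0 := by
  unfold zz
  rcases s i <;> rcases s (i+1) <;> simp [mon] <;> ring

lemma zz_adm (hp : 3 ≤ p) (hodd : Odd p) (s : Fin t → Bool) : Adm p s (zz (k := k) p s) := by
  intro i
  rw [zz_cases]
  rcases s i <;> rcases s (i+1) <;> simp only [Sub_t, Sub_t', Sub_ff]
  · exact mon_U hp hodd (by omega) (by omega)
  · exact mon_hom' (by simp [dg])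
  · exact mon_hom' (by simp [dg]; omega)
  · exact mon_hom' (by simp [dg]; omega)

lemma mon_eq_monomial (m : Fin 4 →₀ ℕ) : (monomial m (1:k)) = mon (m 0) (m 1) (m 2) (m 3) := by
  rw [monomial_eq, Finsupp.prod_fintype _ _ (by simp), Fin.prod_univ_four, mon]; simp

lemma hom_le_span (n : ℕ) : hom k n ≤ Submodule.span k {x | ∃ a b c d, a + b + c + d = n ∧ x = mon a b c d} := by
  intro x hx
  rw [x.as_sum]
  refine Submodule.sum_mem _ fun m hm => ?_
  have h1 : monomial m (coeff m x) = coeff m x • monomial m (1:k) := by simp [smul_monomial]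
  rw [h1]
  refine Submodule.smul_mem _ _ (Submodule.subset_span ⟨m 0, m 1, m 2, m 3, ?_, mon_eq_monomial m⟩)
  have := hx (mem_support_iff.1 hm)
  rw [← this, Finsupp.weight_apply, Finsupp.sum_fintype _ _ (by simp), Fin.sum_univ_four]; simp

lemma slot (hq : Fintype.card k = p ^ t) (hp : 3 ≤ p) (hodd : Odd p) {s : Fin t → Bool}
    (hN : Ngt k p s ≤ C0 k (p^t)) {F : Fin t → Pol k} (h : Adm p s F) (i : Fin t)
    (hz : L k p t (Function.update F i (zz p s i)) ∈ C0 k (p^t)) : L k p t F ∈ C0 k (p^t) := by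
  let A : Submodule k (Pol k) :=
    (Sub k p (s i) (s (i+1))) ⊓ (C0 k (p^t)).comap ((L k p t).toLinearMap F i)
  have hA : ∀ x, x ∈ A ↔ x ∈ Sub k p (s i) (s (i+1)) ∧ L k p t (Function.update F i x) ∈ C0 k (p^t) :=
    fun x => Iff.rfl
  have hzA : zz p s i ∈ A := (hA _).2 ⟨zz_adm hp hodd s i, hz⟩
  have hDA : ∀ u : Fin 4 → k, (∀ j, u j ^ p = u j) → ∀ x ∈ A, D u x ∈ A := by
    intro u hu x hx
    rw [hA] at hx ⊢
    refine ⟨D_Sub u hx.1, ?_⟩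
    have := close_D hq hN (adm_update h i hx.1) hx.2 u hu i
    simpa using this
  have hppA : ∀ x, x ∈ pp k p → x ∈ Sub k p (s i) (s (i+1)) → x ∈ A := by
    intro x hx hx'
    refine (hA _).2 ⟨hx', hN (carry hq (adm_update h i hx') i (by simpa using hx))⟩
  have hp0 : p ≠ 0 := by omega
  have hclo : Clo p (A ⊔ (pp k p).restrictScalars k) := by
    have key : ∀ δ : Derivation k (Pol k) (Pol k), (∀ x ∈ A, δ x ∈ A) →
        (∀ x ∈ pp k p, δ x ∈ pp k p) → ∀ x ∈ A ⊔ (pp k p).restrictScalars k,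
        δ x ∈ A ⊔ (pp k p).restrictScalars k := by
      intro δ h1 h2 x hx
      obtain ⟨y, hy, z, hz, rfl⟩ := Submodule.mem_sup.1 hx
      rw [map_add]
      exact Submodule.mem_sup.2 ⟨_, h1 y hy, _, h2 z hz, rfl⟩
    have u0 : ∀ j, (e0 : Fin 4 → k) j ^ p = e0 j := fun j => by fin_cases j <;> simp [e0, hp0]
    have u1 : ∀ j, (e1 : Fin 4 → k) j ^ p = e1 j := fun j => by fin_cases j <;> simp [e1, hp0]
    have u2 : ∀ j, (e2 : Fin 4 → k) j ^ p = e2 j := fun j => by fin_cases j <;> simp [e2, hp0]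
    have u3 : ∀ j, (e3 : Fin 4 → k) j ^ p = e3 j := fun j => by fin_cases j <;> simp [e3, hp0]
    have u12 : ∀ j, (e1 + e2 : Fin 4 → k) j ^ p = (e1 + e2 : Fin 4 → k) j :=
      fun j => by fin_cases j <;> simp [e1, e2, hp0]
    exact ⟨fun x hx => Submodule.mem_sup_right hx,
      key _ (hDA _ u0) (fun x => D_mem_pp p _),
      key _ (hDA _ u1) (fun x => D_mem_pp p _),
      key _ (hDA _ u2) (fun x => D_mem_pp p _),
      key _ (hDA _ u3) (fun x => D_mem_pp p _),
      key _ (fun x hx => Submodule.sub_mem _ (Submodule.sub_mem _ (hDA _ u12 x hx) (hDA _ u1 x hx))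
        (hDA _ u2 x hx)) (fun x => Dsh_mem_pp p _ _)⟩
  have hback : ∀ x ∈ Sub k p (s i) (s (i+1)), x ∈ A ⊔ (pp k p).restrictScalars k → x ∈ A := by
    intro x hx hx'
    obtain ⟨y, hy, z, hz, rfl⟩ := Submodule.mem_sup.1 hx'
    refine Submodule.add_mem _ hy (hppA _ hz ?_)
    have := Submodule.sub_mem _ hx ((hA _).1 hy).1
    rwa [add_sub_cancel_left] at this
  have hall : Sub k p (s i) (s (i+1)) ≤ A := by
    have hz' : zz p s i ∈ A ⊔ (pp k p).restrictScalars k := Submodule.mem_sup_left hzA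
    rw [zz_cases] at hz'
    generalize hα : s i = α at *
    generalize hβ : s (i+1) = β at *
    rcases α <;> rcases β <;> simp only [] at hz'
    · intro x hx
      refine hback x hx ?_
      rw [Sub_ff] at hx
      refine (sup_le (Submodule.span_le.2 ?_) (inf_le_left.trans le_sup_right) :
        U k p ≤ A ⊔ (pp k p).restrictScalars k) hx
      rintro _ ⟨a, b, c, d, h, rfl⟩
      exact gen_ff hp hodd hclo hz' h
    · intro x hx
      refine hback x hx ?_
      rw [Sub_t] at hx
      refine (Submodule.span_le.2 ?_) (hom_le_span _ hx)
      rintro _ ⟨a, b, c, d, h, rfl⟩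
      exact gen_ft hp hclo hz' h
    · intro x hx
      refine hback x hx ?_
      rw [Sub_t'] at hx
      refine (Submodule.span_le.2 ?_) (hom_le_span _ hx)
      rintro _ ⟨a, b, c, d, h, rfl⟩
      exact gen_tf hp hclo hz' h
    · intro x hx
      refine hback x hx ?_
      rw [Sub_t] at hx
      refine (Submodule.span_le.2 ?_) (hom_le_span _ hx)
      rintro _ ⟨a, b, c, d, h, rfl⟩
      exact gen_tt hp hclo hz' h
  have := ((hA _).1 (hall (h i))).2
  simpa using this

lemma NN_le_C0 (hq : Fintype.card k = p ^ t) (hp : 3 ≤ p) (hodd : Odd p) (s : Fin t → Bool) :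
    NN k p s ≤ C0 k (p^t) := by
  induction s using WellFoundedGT.induction with
  | ind s ih =>
    have hN : Ngt k p s ≤ C0 k (p^t) := iSup_le fun s' => ih s'.1 s'.2
    have key : ∀ T : Finset (Fin t), ∀ F : Fin t → Pol k, Adm p s F → (∀ i ∉ T, F i = zz p s i) →
        L k p t F ∈ C0 k (p^t) := by
      intro T
      induction T using Finset.induction_on with
      | empty =>
        intro F _ h
        have : F = zz p s := funext fun i => h i (by simp)
        rw [this]; exact start3 hq hp s
      | insert a T ha ihT =>
        intro F hF h
        refine slot hq hp hodd hN hF a (ihT _ (adm_update hF a (zz_adm hp hodd s a)) ?_)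
        intro i hi
        by_cases hia : i = a
        · subst hia; simp
        · rw [Function.update_of_ne hia]; exact h i (by simp [hi, hia])
    rw [NN, Submodule.span_le]
    rintro _ ⟨F, hF, rfl⟩
    exact key Finset.univ F hF (by simp)

lemma C0_le_NN (hp : 3 ≤ p) (hodd : Odd p) :
    C0 k (p^t) ≤ NN k p (fun _ : Fin t => false) := by
  rw [C0, Submodule.span_le]
  rintro _ ⟨f, g, hfg, rfl⟩
  refine Submodule.subset_span ⟨_, ?_, gn_eq_L f g⟩
  intro i
  simp only [Sub_ff]
  refine PP_U hp hodd _ _ ?_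
  have := congrArg (iterateFrobenius k p i) hfg
  simp only [B, map_sub, map_add, map_mul, map_zero, iterateFrobenius_def] at this
  exact this

end levels3
end W3



namespace W3
open MvPolynomial

section family
variable {k : Type} [Field k] [Fintype k]
variable {p : ℕ} [Fact p.Prime] [CharP k p] {t : ℕ} [NeZero t]

abbrev Ex (p : ℕ) := Fin 4 → Fin p

def mo (k : Type) [Field k] (e : Ex p) : Pol k := mon (e 0) (e 1) (e 2) (e 3)

def du (e : Ex p) : Ex p := ![(e 1).rev, (e 0).rev, (e 3).rev, (e 2).rev]

def kp (k : Type) [Field k] (e : Ex p) : k := kap (e 0) (e 1) (e 2) (e 3)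

lemma fac_k {a : ℕ} (h : a < p) : (a.factorial : k) * ((p-1-a).factorial : k) = (-1) ^ (a+1) := by
  induction a with
  | zero => simp [wilson_k]
  | succ a ih =>
    have h1 := ih (by omega)
    rw [show p - 1 - a = (p - 1 - (a+1)) + 1 by omega, Nat.factorial_succ,
      show p - 1 - (a+1) + 1 = p - 1 - a by omega, Nat.cast_mul, cast_dual p (by omega)] at h1
    rw [Nat.factorial_succ]; push_cast
    rw [pow_succ, ← h1]; ring

lemma kp_self (e : Ex p) (h1 : (e 0 : ℕ) + e 1 = p - 1) (h2 : (e 2 : ℕ) + e 3 = p - 1) : kp k e = 1 := by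
  have a1 := fac_k (k := k) (e 1).2
  have a2 := fac_k (k := k) (e 3).2
  rw [show p - 1 - (e 1 : ℕ) = e 0 by omega] at a1
  rw [show p - 1 - (e 3 : ℕ) = e 2 by omega] at a2
  have : kp k e = (-1) ^ ((e 1 : ℕ) + e 3) * (((e 1 : ℕ).factorial : k) * ((e 0 : ℕ).factorial : k)) *
    (((e 3 : ℕ).factorial : k) * ((e 2 : ℕ).factorial : k)) := by rw [kp, kap]; ring
  rw [this, a1, a2]
  have : ((-1 : k) ^ ((e 1 : ℕ) + e 3) * (-1) ^ ((e 1 : ℕ) + 1) * (-1) ^ ((e 3 : ℕ) + 1)) =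
    ((-1) ^ 2) ^ ((e 1 : ℕ) + e 3 + 1) := by rw [← pow_mul]; ring
  rw [this]; simp

lemma kp_du (e : Ex p) (hodd : Odd p) (he : (e 0 : ℕ) + e 1 + e 2 + e 3 = 2*p-2) : kp k e * kp k (du e) = 1 := by
  have a0 := fac_k (k := k) (e 0).2
  have a1 := fac_k (k := k) (e 1).2
  have a2 := fac_k (k := k) (e 2).2
  have a3 := fac_k (k := k) (e 3).2
  have hr : ∀ j, ((e j).rev : ℕ) = p - 1 - (e j : ℕ) := fun j => by rw [Fin.val_rev]; omega
  have : kp k e * kp k (du e) = (-1) ^ ((e 1 : ℕ) + e 3 + (p-1-(e 0:ℕ) + (p-1-(e 2:ℕ)))) *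
    (((e 0 : ℕ).factorial : k) * ((p-1-(e 0 : ℕ)).factorial : k)) *
    (((e 1 : ℕ).factorial : k) * ((p-1-(e 1 : ℕ)).factorial : k)) *
    (((e 2 : ℕ).factorial : k) * ((p-1-(e 2 : ℕ)).factorial : k)) *
    (((e 3 : ℕ).factorial : k) * ((p-1-(e 3 : ℕ)).factorial : k)) := by
    simp only [kp, kap, du, Matrix.cons_val, hr]; ring
  rw [this, a0, a1, a2, a3, ← pow_add, ← pow_add, ← pow_add, ← pow_add]
  apply Even.neg_one_pow
  have h0 := (e 0).2
  have h2 := (e 2).2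
  obtain ⟨n, hn⟩ := hodd
  rw [Nat.even_iff]; omega

/-- index sets -/
def Bs (p : ℕ) (a b : Bool) : Finset (Ex p) :=
  Finset.univ.filter fun e => (e 0 : ℕ) + e 1 + e 2 + e 3 = dg p a b ∧
    ((a = false ∧ b = false) → (e 0 : ℕ) + e 1 ≤ p - 1)

/-- coefficient vectors -/
def vc (k : Type) [Field k] (a b : Bool) (e e' : Ex p) : k :=
  (if e' = e then 1 else 0) + (if a = false ∧ b = false then kp k e * (if e' = du e then 1 else 0) else 0)

def ve (k : Type) [Field k] (a b : Bool) (e : Ex p) : Pol k := ∑ e', vc k a b e e' • mo k e'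

lemma ve_ne {a b : Bool} (h : ¬ (a = false ∧ b = false)) (e : Ex p) : ve k a b e = mo k e := by
  simp [ve, vc, h]

lemma mo_du (e : Ex p) : mo k (du e) = dmon p (e 0) (e 1) (e 2) (e 3) := by
  have hr : ∀ j, ((e j).rev : ℕ) = p - 1 - (e j : ℕ) := fun j => by rw [Fin.val_rev]; omega
  simp only [mo, du, dmon, Matrix.cons_val, hr]

lemma ve_ff (e : Ex p) : ve k false false e = wU p (e 0) (e 1) (e 2) (e 3) := by
  rw [wU_red p ⟨(e 0).2, (e 1).2, (e 2).2, (e 3).2⟩, ← mo_du]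
  simp [ve, vc, add_smul, Finset.sum_add_distrib, smul_eq_C_mul]
  rfl

lemma ve_Sub {a b : Bool} {e : Ex p} (h : e ∈ Bs p a b) : ve k a b e ∈ Sub k p a b := by
  simp only [Bs, Finset.mem_filter, Finset.mem_univ, true_and] at h
  by_cases hab : a = false ∧ b = false
  · obtain ⟨rfl, rfl⟩ := hab
    rw [ve_ff, Sub_ff]; exact wU_U p h.1
  · rw [ve_ne hab, Sub, if_neg hab]; exact mon_hom' h.1

lemma exists_ex {a b c d : ℕ} (h : a < p ∧ b < p ∧ c < p ∧ d < p) :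
    ∃ e : Ex p, (e 0 : ℕ) = a ∧ (e 1 : ℕ) = b ∧ (e 2 : ℕ) = c ∧ (e 3 : ℕ) = d :=
  ⟨![⟨a, h.1⟩, ⟨b, h.2.1⟩, ⟨c, h.2.2.1⟩, ⟨d, h.2.2.2⟩], by simp⟩

lemma Sub_le (hodd : Odd p) (a b : Bool) : Sub k p a b ≤
    Submodule.span k (ve k a b '' (Bs p a b : Set (Ex p))) ⊔ (pp k p).restrictScalars k := by
  by_cases hab : a = false ∧ b = false
  · obtain ⟨rfl, rfl⟩ := hab
    rw [Sub_ff]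
    refine sup_le (Submodule.span_le.2 ?_) (inf_le_left.trans le_sup_right)
    rintro _ ⟨a, b, c, d, h, rfl⟩
    by_cases hr : a < p ∧ b < p ∧ c < p ∧ d < p
    swap
    · rw [wU_nred p hr]; exact Submodule.zero_mem _
    obtain ⟨e, rfl, rfl, rfl, rfl⟩ := exists_ex hr
    refine Submodule.mem_sup_left ?_
    by_cases h1 : (e 0 : ℕ) + e 1 ≤ p - 1
    · refine Submodule.subset_span ⟨e, ?_, ve_ff e⟩
      simp [Bs, dg, h1, h]
    · have h2 : wU p (e 0) (e 1) (e 2) (e 3) = kp k e • ve k false false (du e) := by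
        have hr : ∀ j, ((e j).rev : ℕ) = p - 1 - (e j : ℕ) := fun j => by rw [Fin.val_rev]; omega
        have hdd : du (du e) = e := by
          funext j; fin_cases j <;> simp [du]
        have := ve_ff (k := k) e
        rw [← this]
        have h3 : ∀ e : Ex p, ve k false false e = mo k e + kp k e • mo k (du e) := by
          intro e; simp [ve, vc, add_smul, Finset.sum_add_distrib]
        rw [h3, h3, hdd, smul_add, smul_smul, kp_du e hodd h, one_smul, add_comm]
      rw [h2]
      refine Submodule.smul_mem _ _ (Submodule.subset_span ⟨du e, ?_, rfl⟩)
      have hr : ∀ j, ((e j).rev : ℕ) = p - 1 - (e j : ℕ) := fun j => by rw [Fin.val_rev]; omega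
      simp only [Bs, dg, Finset.coe_filter, Finset.mem_univ, true_and, Set.mem_setOf_eq, du, Matrix.cons_val, hr]
      omega
  · rw [Sub, if_neg hab]
    refine (hom_le_span _).trans (Submodule.span_le.2 ?_)
    rintro _ ⟨a', b', c, d, h, rfl⟩
    by_cases hr : a' < p ∧ b' < p ∧ c < p ∧ d < p
    swap
    · exact Submodule.mem_sup_right (mon_mem_pp (by omega))
    obtain ⟨e, rfl, rfl, rfl, rfl⟩ := exists_ex hr
    refine Submodule.mem_sup_left (Submodule.subset_span ⟨e, ?_, ve_ne hab e⟩)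
    simp [Bs, hab, h]

abbrev J (p t : ℕ) [NeZero t] := Σ s : Fin t → Bool, (i : Fin t) → {e // e ∈ Bs p (s i) (s (i+1))}

def fv (k : Type) [Field k] [Fintype k] (x : J p t) : Fn k :=
  L k p t (fun i => ve k (x.1 i) (x.1 (i+1)) (x.2 i).1)

lemma NN_le_fv (hq : Fintype.card k = p ^ t) (hodd : Odd p) (s : Fin t → Bool) :
    NN k p s ≤ Submodule.span k (Set.range (fv k : J p t → Fn k)) := by
  induction s using WellFoundedGT.induction with
  | ind s ih =>
    have hN : Ngt k p s ≤ Submodule.span k (Set.range (fv k : J p t → Fn k)) :=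
      iSup_le fun s' => ih s'.1 s'.2
    rw [NN, Submodule.span_le]
    rintro _ ⟨F, hF, rfl⟩
    have h1 : ∀ i, ∃ c : {e // e ∈ Bs p (s i) (s (i+1))} → k,
        F i - (∑ e, c e • ve k (s i) (s (i+1)) e.1) ∈ pp k p := by
      intro i
      obtain ⟨y, hy, z, hz, hyz⟩ := Submodule.mem_sup.1 (Sub_le hodd _ _ (hF i))
      rw [Set.image_eq_range] at hy
      obtain ⟨c, hc⟩ := (Submodule.mem_span_range_iff_exists_fun k).1 hy
      refine ⟨c, ?_⟩
      have : F i - y = z := by rw [← hyz]; simp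
      rw [← this, ← hc] at hz
      exact hz
    choose c hc using h1
    have h2 := hN (congr_L hq hF (fun i => Submodule.sum_mem _ fun e _ =>
      Submodule.smul_mem _ _ (ve_Sub e.2)) hc)
    rw [MultilinearMap.map_sum] at h2
    refine (Submodule.sub_mem_iff_left _ ?_).1 h2
    refine Submodule.sum_mem _ fun r _ => ?_
    rw [MultilinearMap.map_smul_univ]
    exact Submodule.smul_mem _ _ (Submodule.subset_span ⟨⟨s, r⟩, rfl⟩)

lemma C0_eq (hq : Fintype.card k = p ^ t) (hp : 3 ≤ p) (hodd : Odd p) :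
    C0 k (p^t) = Submodule.span k (Set.range (fv k : J p t → Fn k)) := by
  apply le_antisymm
  · exact (C0_le_NN hp hodd).trans (NN_le_fv hq hodd _)
  · rw [Submodule.span_le]
    rintro _ ⟨x, rfl⟩
    exact NN_le_C0 hq hp hodd x.1 (Submodule.subset_span ⟨_, fun i => ve_Sub (x.2 i).2, rfl⟩)

/-- monomial exponents -/
def ne (r : Fin t → Ex p) : Fin 4 →₀ ℕ := Finsupp.equivFunOnFinite.symm
  (fun j => (finFunctionFinEquiv (fun i => r i j) : ℕ))

lemma ne_inj : Function.Injective (ne : (Fin t → Ex p) → (Fin 4 →₀ ℕ)) := by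
  intro r r' h
  have h1 := Finsupp.equivFunOnFinite.symm.injective h
  funext i j
  have h2 := congrFun h1 j
  exact congrFun (finFunctionFinEquiv.injective (Fin.ext h2)) i

lemma L_mo (r : Fin t → Ex p) (v : Fin 4 → k) :
    L k p t (fun i => mo k (r i)) v = eval v (monomial (ne r) (1:k)) := by
  rw [Lap_apply, eval_monomial, one_mul, Finsupp.prod_fintype _ _ (by simp), Finset.prod_apply]
  have h1 : ∀ j, v j ^ (ne r j) = ∏ i : Fin t, (v j ^ p ^ (i:ℕ)) ^ (r i j : ℕ) := by
    intro j
    simp only [ne, Finsupp.equivFunOnFinite_symm_apply_apply, finFunctionFinEquiv_apply]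
    rw [← Finset.prod_pow_eq_pow_sum]
    refine Finset.prod_congr rfl fun i _ => ?_
    rw [← pow_mul, mul_comm]
  simp only [h1]
  rw [Finset.prod_comm]
  refine Finset.prod_congr rfl fun i _ => ?_
  simp [mo, mon, Fin.prod_univ_four, evF_X]

lemma mo_indep (hq : Fintype.card k = p ^ t) (c : (Fin t → Ex p) → k)
    (h : ∑ r, c r • L k p t (fun i => mo k (r i)) = 0) : ∀ r, c r = 0 := by
  let P : Pol k := ∑ r, monomial (ne r) (c r)
  have hP : P = 0 := by
    refine eq_zero_of_eval_eq_zero _ _ P (fun v => ?_) ?_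
    · have := congrFun h v
      simp only [Finset.sum_apply, Pi.smul_apply, L_mo, smul_eq_mul, Pi.zero_apply, eval_monomial, one_mul] at this
      simpa [P, eval_monomial] using this
    · refine Submodule.sum_mem _ fun r _ => ?_
      rw [mem_restrictDegree]
      intro s hs i
      have : s = ne r := by
        have := support_monomial_subset hs
        simpa using this
      rw [this, hq]
      have := (finFunctionFinEquiv (fun l => r l i)).2
      simp only [ne, Finsupp.equivFunOnFinite_symm_apply_apply]
      omega
  intro r
  have := congrArg (coeff (ne r)) hP
  simpa [P, coeff_sum, coeff_monomial, ne_inj.eq_iff] using this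

lemma fv_eq (x : J p t) : fv k x = ∑ r : Fin t → Ex p,
    (∏ i, vc k (x.1 i) (x.1 (i+1)) (x.2 i).1 (r i)) • L k p t (fun i => mo k (r i)) := by
  simp only [fv, ve]
  rw [MultilinearMap.map_sum]
  exact Finset.sum_congr rfl fun r _ => by rw [MultilinearMap.map_smul_univ]

lemma dg_inj (hp : 3 ≤ p) {a b a' b' : Bool} (h : dg p a b = dg p a' b') : a = a' ∧ b = b' := by
  cases a <;> cases b <;> cases a' <;> cases b' <;> simp [dg] at h ⊢ <;> omega

lemma vc_self (hp : 3 ≤ p) {a b : Bool} {e : Ex p} (h : e ∈ Bs p a b) : vc k a b e e ≠ 0 := by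
  simp only [Bs, Finset.mem_filter, Finset.mem_univ, true_and] at h
  unfold vc
  rw [if_pos rfl]
  split_ifs with h1 h2
  · have h3 : (e 0 : ℕ) = p - 1 - e 1 := by
      have := congrArg Fin.val (congrFun h2 0)
      simp [du] at this; omega
    have h4 : (e 2 : ℕ) = p - 1 - e 3 := by
      have := congrArg Fin.val (congrFun h2 2)
      simp [du] at this; omega
    rw [kp_self e (by omega) (by omega)]
    have := natCast_ne (k := k) (p := p) (n := 2) (by omega) (by omega)
    norm_num
    exact_mod_cast this
  · simp
  · simp

lemma vc_ne (hp : 3 ≤ p) {a b a' b' : Bool} {e e' : Ex p} (h : e ∈ Bs p a b) (h' : e' ∈ Bs p a' b')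
    (hv : vc k a b e e' ≠ 0) : a = a' ∧ b = b' ∧ e = e' := by
  simp only [Bs, Finset.mem_filter, Finset.mem_univ, true_and] at h h'
  by_cases he : e' = e
  · subst he
    obtain ⟨h1, h2⟩ := dg_inj hp (h.1.symm.trans h'.1)
    exact ⟨h1, h2, rfl⟩
  unfold vc at hv
  rw [if_neg he, zero_add] at hv
  split_ifs at hv with h1 h2
  · have hr : ∀ j, ((e j).rev : ℕ) = p - 1 - (e j : ℕ) := fun j => by rw [Fin.val_rev]; omega
    obtain ⟨rfl, rfl⟩ := h1
    have g0 := (e 0).2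
    have g1 := (e 1).2
    have g2 := (e 2).2
    have g3 := (e 3).2
    have f0 : (e' 0 : ℕ) = p - 1 - e 1 := by rw [h2, ← hr]; simp [du]
    have f1 : (e' 1 : ℕ) = p - 1 - e 0 := by rw [h2, ← hr]; simp [du]
    have f2 : (e' 2 : ℕ) = p - 1 - e 3 := by rw [h2, ← hr]; simp [du]
    have f3 : (e' 3 : ℕ) = p - 1 - e 2 := by rw [h2, ← hr]; simp [du]
    have hd : dg p false false = 2*p-2 := rfl
    have : dg p a' b' = dg p false false := by rw [← h'.1, hd]; rw [hd] at h; omega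
    obtain ⟨rfl, rfl⟩ := dg_inj hp this
    refine ⟨rfl, rfl, ?_⟩
    have a1 := h.2 ⟨rfl, rfl⟩
    have a2 := h'.2 ⟨rfl, rfl⟩
    have a3 := h.1
    rw [hd] at a3
    funext j
    apply Fin.ext
    fin_cases j <;> simp only [Fin.zero_eta, Fin.mk_one, Fin.reduceFinMk] <;> omega
  · simp at hv
  · simp at hv

lemma fv_indep (hq : Fintype.card k = p ^ t) (hp : 3 ≤ p) :
    LinearIndependent k (fv k : J p t → Fn k) := by
  rw [Fintype.linearIndependent_iff]
  intro g hg x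
  simp only [fv_eq, Finset.smul_sum, smul_smul] at hg
  rw [Finset.sum_comm] at hg
  simp only [← Finset.sum_smul] at hg
  have h1 := mo_indep hq _ hg (fun i => (x.2 i).1)
  rw [Finset.sum_eq_single x] at h1
  · rcases mul_eq_zero.1 h1 with h | h
    · exact h
    · exact absurd h (Finset.prod_ne_zero_iff.2 fun i _ => vc_self hp (x.2 i).2)
  · intro y _ hy
    by_contra hne
    have h2 := Finset.prod_ne_zero_iff.1 (right_ne_zero_of_mul hne)
    apply hy
    have h3 := fun i => vc_ne hp (y.2 i).2 (x.2 i).2 (h2 i (Finset.mem_univ i))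
    obtain ⟨s, m⟩ := y
    obtain ⟨s', m'⟩ := x
    have : s = s' := funext fun i => (h3 i).1
    subst this
    congr 1
    funext i
    exact Subtype.ext (h3 i).2.2
  · simp

lemma finrank_C0 (hq : Fintype.card k = p ^ t) (hp : 3 ≤ p) (hodd : Odd p) :
    Module.finrank k (C0 k (p^t)) = ∑ s : Fin t → Bool, ∏ i, (Bs p (s i) (s (i+1))).card := by
  rw [C0_eq hq hp hodd, finrank_span_eq_card (fv_indep hq hp), Fintype.card_sigma]
  simp

end family
end W3



namespace W3

section count

lemma N2_card (p x : ℕ) (hp : 0 < p) :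
    ((Finset.univ : Finset (Fin p × Fin p)).filter (fun z => (z.1 : ℕ) + z.2 = x)).card =
      if x < p then x + 1 else 2 * p - 1 - x := by
  have h1 : ((Finset.univ : Finset (Fin p × Fin p)).filter (fun z => (z.1 : ℕ) + z.2 = x)).card =
      (Finset.Icc (x + 1 - p) (min x (p-1))).card := by
    refine Finset.card_bij (fun z _ => (z.1 : ℕ)) ?_ ?_ ?_
    · intro z hz
      simp only [Finset.mem_filter, Finset.mem_univ, true_and] at hz
      rw [Finset.mem_Icc]; omega
    · intro z hz w hw h
      simp only [Finset.mem_filter, Finset.mem_univ, true_and] at hz hw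
      ext
      · exact h
      · omega
    · intro a ha
      rw [Finset.mem_Icc] at ha
      exact ⟨(⟨a, by omega⟩, ⟨x - a, by omega⟩), by simp; omega, rfl⟩
  rw [h1, Nat.card_Icc]
  split_ifs <;> omega

def N2 (p x : ℕ) : ℕ := if x < p then x + 1 else 2 * p - 1 - x

lemma S_card (p n H : ℕ) (hp : 0 < p) (hH : H ≤ n + 1) :
    ((Finset.univ : Finset (Ex p)).filter (fun e => (e 0 : ℕ) + e 1 + e 2 + e 3 = n ∧
      (e 0 : ℕ) + e 1 < H)).card = ∑ x ∈ Finset.range H, N2 p x * N2 p (n - x) := by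
  rw [Finset.card_eq_sum_card_fiberwise (f := fun e : Ex p => (e 0 : ℕ) + e 1) (t := Finset.range H)
    (fun e he => by simp at he ⊢; exact he.2)]
  refine Finset.sum_congr rfl fun x hx => ?_
  rw [Finset.mem_range] at hx
  rw [N2, N2, ← N2_card p x hp, ← N2_card p (n-x) hp, ← Finset.card_product]
  refine Finset.card_bij (fun e _ => ((e 0, e 1), (e 2, e 3))) ?_ ?_ ?_
  · intro e he
    simp only [Finset.mem_filter, Finset.mem_univ, true_and, Finset.mem_product] at he ⊢
    omega
  · intro e _ e' _ h
    simp only [Prod.mk.injEq] at h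
    funext j
    fin_cases j
    · exact h.1.1
    · exact h.1.2
    · exact h.2.1
    · exact h.2.2
  · rintro ⟨⟨a, b⟩, ⟨c, d⟩⟩ h
    simp only [Finset.mem_filter, Finset.mem_univ, true_and, Finset.mem_product] at h
    refine ⟨![a,b,c,d], ?_, by simp⟩
    simp only [Finset.mem_filter, Finset.mem_univ, true_and, Matrix.cons_val]
    omega

lemma sum1 (P : ℝ) (m : ℕ) : ∑ j ∈ Finset.range m, ((j:ℝ)+1)*(P - j) =
    (3 * P * m * (m+1) - 2 * ((m:ℝ)-1)*m*(m+1))/6 := by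
  induction m with
  | zero => simp
  | succ m ih => rw [Finset.sum_range_succ, ih]; push_cast; ring

lemma sum2 (m : ℕ) : ∑ j ∈ Finset.range m, ((j:ℝ)+1)*j = ((m:ℝ)-1)*m*(m+1)/3 := by
  induction m with
  | zero => simp
  | succ m ih => rw [Finset.sum_range_succ, ih]; push_cast; ring

lemma sum3 (m : ℕ) : ∑ j ∈ Finset.range m, ((j:ℝ)+1)*(j+1) = (m:ℝ)*(m+1)*(2*m+1)/6 := by
  induction m with
  | zero => simp
  | succ m ih => rw [Finset.sum_range_succ, ih]; push_cast; ring

lemma Bs_ff (p : ℕ) (hp : 3 ≤ p) : ((Bs p false false).card : ℝ) = (p:ℝ)*(p+1)*(2*p+1)/6 := by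
  have : Bs p false false = (Finset.univ : Finset (Ex p)).filter
      (fun e => (e 0 : ℕ) + e 1 + e 2 + e 3 = 2*p-2 ∧ (e 0 : ℕ) + e 1 < p) := by
    ext e; simp [Bs, dg]; omega
  rw [this, S_card p _ p (by omega) (by omega), ← sum3]
  push_cast
  refine Finset.sum_congr rfl fun j hj => ?_
  rw [Finset.mem_range] at hj
  rw [N2, if_pos hj, N2]
  have : (if 2*p-2-j < p then 2*p-2-j+1 else 2*p-1-(2*p-2-j)) = j+1 := by split_ifs <;> omega
  rw [this]; push_cast; rfl

lemma Bs_tt (p : ℕ) (hp : 3 ≤ p) : ((Bs p true true).card : ℝ) = (p:ℝ)*(p+1)*(p+2)/6 := by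
  have : Bs p true true = (Finset.univ : Finset (Ex p)).filter
      (fun e => (e 0 : ℕ) + e 1 + e 2 + e 3 = p-1 ∧ (e 0 : ℕ) + e 1 < p) := by
    ext e; simp [Bs, dg]; omega
  rw [this, S_card p _ p (by omega) (by omega)]
  have := sum1 p p
  rw [show (p:ℝ)*(p+1)*(p+2)/6 = (3 * (p:ℝ) * p * (p+1) - 2 * ((p:ℝ)-1)*p*(p+1))/6 by ring, ← this]
  push_cast
  refine Finset.sum_congr rfl fun j hj => ?_
  rw [Finset.mem_range] at hj
  rw [N2, if_pos hj, N2, if_pos (by omega), show p - 1 - j + 1 = p - j by omega, Nat.cast_sub hj.le]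
  push_cast; rfl

lemma Bs_ft (p : ℕ) (hp : 3 ≤ p) : ((Bs p false true).card : ℝ) = (p:ℝ)*(p+1)*(p-1)/6 := by
  have : Bs p false true = (Finset.univ : Finset (Ex p)).filter
      (fun e => (e 0 : ℕ) + e 1 + e 2 + e 3 = p-2 ∧ (e 0 : ℕ) + e 1 < p-1) := by
    ext e; simp [Bs, dg]; omega
  rw [this, S_card p _ (p-1) (by omega) (by omega)]
  have := sum1 (p-1) (p-1)
  rw [Nat.cast_sub (by omega)] at this
  have h2 : (p:ℝ)*(p+1)*(p-1)/6 = ∑ j ∈ Finset.range (p-1), ((j:ℝ)+1)*((p:ℝ)-1-j) := by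
    rw [this]; push_cast; ring
  rw [h2]
  push_cast
  refine Finset.sum_congr rfl fun j hj => ?_
  rw [Finset.mem_range] at hj
  rw [N2, if_pos (by omega), N2, if_pos (by omega), show p - 2 - j + 1 = p - 1 - j by omega, Nat.cast_sub hj.le,
    Nat.cast_sub (by omega)]
  push_cast; rfl

lemma Bs_tf (p : ℕ) (hp : 3 ≤ p) : ((Bs p true false).card : ℝ) = 2*(p:ℝ)*(p+1)*(p-1)/3 := by
  have : Bs p true false = (Finset.univ : Finset (Ex p)).filter
      (fun e => (e 0 : ℕ) + e 1 + e 2 + e 3 = 2*p-1 ∧ (e 0 : ℕ) + e 1 < p + p) := by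
    ext e; simp [Bs, dg]; omega
  rw [this, S_card p _ (p + p) (by omega) (by omega), Finset.sum_range_add]
  have h1 : ∑ x ∈ Finset.range p, N2 p x * N2 p (2*p-1-x) = ∑ j ∈ Finset.range p, (j+1)*j := by
    refine Finset.sum_congr rfl fun j hj => ?_
    rw [Finset.mem_range] at hj
    rw [N2, if_pos hj, N2, if_neg (by omega), show 2*p-1-(2*p-1-j) = j by omega]
  have h2 : ∑ x ∈ Finset.range p, N2 p (p+x) * N2 p (2*p-1-(p+x)) = ∑ j ∈ Finset.range p, (j+1)*j := by
    rw [← Finset.sum_range_reflect]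
    refine Finset.sum_congr rfl fun j hj => ?_
    rw [Finset.mem_range] at hj
    rw [N2, if_neg (by omega), N2, if_pos (by omega), mul_comm]
    congr 1 <;> omega
  rw [h1, h2]
  push_cast
  rw [sum2]; ring

lemma path_sum {R ι : Type} [CommRing R] [Fintype ι] [DecidableEq ι] (M : Matrix ι ι R) (n : ℕ) (f g : ι → R) :
    ∑ s : Fin (n+1) → ι, f (s 0) * (∏ i : Fin n, M (s i.castSucc) (s i.succ)) * g (s (Fin.last n)) =
      ∑ a, ∑ b, f a * (M ^ n) a b * g b := by
  induction n generalizing f with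
  | zero =>
    rw [← (Equiv.funUnique (Fin 1) ι).symm.sum_comp]
    simp [Matrix.one_apply]
  | succ n ih =>
    rw [← (Fin.consEquiv (fun _ => ι)).sum_comp, Fintype.sum_prod_type, Finset.sum_comm]
    have := ih (fun b => ∑ a, f a * M a b)
    simp only [Fin.consEquiv_apply, Fin.cons_zero, Fin.prod_univ_succ, Fin.castSucc_zero, Fin.cons_succ,
      ← Fin.succ_last, ← Fin.succ_castSucc]
    calc _ = _ := ?_
      _ = _ := this
      _ = _ := ?_
    · refine Finset.sum_congr rfl fun s _ => ?_
      rw [Finset.sum_mul, Finset.sum_mul]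
      exact Finset.sum_congr rfl fun a _ => by ring
    · simp only [pow_succ', Matrix.mul_apply, Finset.sum_mul, Finset.mul_sum]
      rw [Finset.sum_comm_cycle]
      refine Finset.sum_congr rfl fun a _ => ?_
      rw [Finset.sum_comm]
      refine Finset.sum_congr rfl fun b _ => Finset.sum_congr rfl fun c _ => ?_
      ring

lemma cyc_sum {R ι : Type} [CommRing R] [Fintype ι] [DecidableEq ι] (M : Matrix ι ι R) (t : ℕ) [NeZero t] :
    ∑ s : Fin t → ι, ∏ i, M (s i) (s (i+1)) = (M ^ t).trace := by
  obtain ⟨n, rfl⟩ := Nat.exists_eq_succ_of_ne_zero (NeZero.ne t)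
  have h1 : ∀ s : Fin (n+1) → ι, ∏ i, M (s i) (s (i+1)) = ∑ c : ι, (if s 0 = c then 1 else 0) *
      (∏ i : Fin n, M (s i.castSucc) (s i.succ)) * M (s (Fin.last n)) c := by
    intro s
    rw [Finset.sum_eq_single (s 0) (fun b _ hb => by simp [hb.symm]) (by simp), Fin.prod_univ_castSucc]
    simp [Fin.coeSucc_eq_succ, Fin.last_add_one]
  show ∑ s : Fin (n+1) → ι, ∏ i, M (s i) (s (i+1)) = _
  simp only [h1]
  rw [Finset.sum_comm, Nat.succ_eq_add_one, pow_succ, Matrix.trace]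
  refine Finset.sum_congr rfl fun c _ => ?_
  have := path_sum M n (fun a => if a = c then 1 else 0) (fun b => M b c)
  rw [this, Matrix.diag_apply, Matrix.mul_apply]
  simp

lemma trace_pow (M : Matrix Bool Bool ℝ) (x y : ℝ) (h1 : x + y = M.trace)
    (h2 : x * y = M true true * M false false - M true false * M false true) (n : ℕ) :
    (M ^ n).trace = x ^ n + y ^ n := by
  have hM : M ^ 2 = (x + y) • M - (x * y) • (1 : Matrix Bool Bool ℝ) := by
    rw [h1, h2, pow_two]
    ext a b
    cases a <;> cases b <;> simp [Matrix.mul_apply, Matrix.trace, Fintype.sum_bool] <;> ring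
  induction n using Nat.twoStepInduction with
  | zero => simp [Matrix.trace]; norm_num
  | one => simp [h1]
  | more n i1 i2 =>
    have : M ^ (n+2) = (x+y) • M ^ (n+1) - (x*y) • M ^ n := by
      rw [pow_add, hM, mul_sub, Matrix.mul_smul, Matrix.mul_smul, mul_one, pow_succ]
    rw [this, Matrix.trace_sub, Matrix.trace_smul, Matrix.trace_smul, i1, i2]
    simp only [smul_eq_mul]; ring

lemma count_final (p t : ℕ) [NeZero t] (hp : 3 ≤ p) :
    ((∑ s : Fin t → Bool, ∏ i, (Bs p (s i) (s (i+1))).card : ℕ) : ℝ) =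
    ((p:ℝ)*((p:ℝ)+1)^2/4 + (p:ℝ)*((p:ℝ)+1)*((p:ℝ)-1)/12*Real.sqrt 17)^t +
    ((p:ℝ)*((p:ℝ)+1)^2/4 - (p:ℝ)*((p:ℝ)+1)*((p:ℝ)-1)/12*Real.sqrt 17)^t := by
  let M : Matrix Bool Bool ℝ := fun a b => ((Bs p a b).card : ℝ)
  push_cast
  rw [show (∑ s : Fin t → Bool, ∏ i, ((Bs p (s i) (s (i+1))).card : ℝ)) =
    ∑ s : Fin t → Bool, ∏ i, M (s i) (s (i+1)) from rfl]
  rw [cyc_sum]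
  apply trace_pow
  · have : M.trace = ((Bs p true true).card : ℝ) + ((Bs p false false).card : ℝ) := by
      rw [Matrix.trace, Fintype.sum_bool]; rfl
    rw [this, Bs_tt p hp, Bs_ff p hp]; ring
  · simp only [M, Bs_tt p hp, Bs_ff p hp, Bs_tf p hp, Bs_ft p hp]
    have : Real.sqrt 17 ^ 2 = 17 := Real.sq_sqrt (by norm_num)
    linear_combination (-((p:ℝ)*((p:ℝ)+1)*((p:ℝ)-1)/12)^2) * this

end count
end W3



namespace W3
open MvPolynomial

section lines
variable {k : Type} [Field k] [Fintype k]

lemma dt_be (f g : Fin 4 → k) : dt f (be g) = B f g := by rw [B_eq, dt]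

lemma dt_add_l (f g v : Fin 4 → k) : dt (f + g) v = dt f v + dt g v := by
  simp [dt, add_mul, Finset.sum_add_distrib]
lemma dt_smul_l (c : k) (f v : Fin 4 → k) : dt (c • f) v = c * dt f v := by
  simp [dt, Finset.mul_sum, mul_assoc]
lemma dt_zero_r (f : Fin 4 → k) : dt f 0 = 0 := by simp [dt]
lemma dt_zero_l (f : Fin 4 → k) : dt 0 f = 0 := by simp [dt]

lemma be_be (u : Fin 4 → k) : be (be u) = -u := by
  funext j; fin_cases j <;> simp [be]

lemma B_be (u w : Fin 4 → k) : B (be u) (be w) = B u w := by simp [B, be]; ring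

lemma be_LI {f g : Fin 4 → k} (h : LinearIndependent k ![f, g]) : LinearIndependent k ![be f, be g] := by
  rw [LinearIndependent.pair_iff] at h ⊢
  intro s t hst
  apply h s t
  have : be (s • be f + t • be g) = - (s • f + t • g) := by
    funext j; fin_cases j <;> simp [be] <;> ring
  rw [hst] at this
  have h0 : be (0 : Fin 4 → k) = 0 := by funext j; fin_cases j <;> simp [be]
  rw [h0] at this
  exact neg_eq_zero.1 this.symm

lemma span_be_finrank {f g : Fin 4 → k} (h : LinearIndependent k ![f, g]) :
    Module.finrank k (Submodule.span k {be f, be g}) = 2 := by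
  have := finrank_span_eq_card (be_LI h)
  rw [Matrix.range_cons_cons_empty] at this
  simpa using this

lemma span_be_mem {f g : Fin 4 → k} (h : LinearIndependent k ![f, g]) (hB : B f g = 0) (v : Fin 4 → k) :
    v ∈ Submodule.span k {be f, be g} ↔ dt f v = 0 ∧ dt g v = 0 := by
  let A : Matrix (Fin 2) (Fin 4) k := Matrix.of ![f, g]
  have hA : ∀ v, v ∈ LinearMap.ker A.mulVecLin ↔ dt f v = 0 ∧ dt g v = 0 := by
    intro v
    rw [LinearMap.mem_ker, Matrix.mulVecLin_apply]
    constructor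
    · intro hv
      exact ⟨congrFun hv 0, congrFun hv 1⟩
    · intro hv
      funext i
      fin_cases i
      · exact hv.1
      · exact hv.2
  rw [← hA]
  have hle : Submodule.span k {be f, be g} ≤ LinearMap.ker A.mulVecLin := by
    rw [Submodule.span_le]
    rintro x hx
    rw [SetLike.mem_coe, hA]
    have hB' : B g f = 0 := by rw [B_swap, hB, neg_zero]
    rcases hx with rfl | hx
    · simp only [dt_be, B_self, hB', true_and]
    · rw [Set.mem_singleton_iff] at hx
      subst hx
      simp only [dt_be, B_self, hB, true_and]
  have hr : A.rank = 2 := by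
    have := LinearIndependent.rank_matrix (M := A) h
    simpa using this
  have hk := LinearMap.finrank_range_add_finrank_ker A.mulVecLin
  rw [← Matrix.rank, hr] at hk
  have : Submodule.span k {be f, be g} = LinearMap.ker A.mulVecLin := by
    apply Submodule.eq_of_le_of_finrank_eq hle
    rw [span_be_finrank h]
    simp at hk
    omega
  rw [this]

lemma B_add_right (f g u : Fin 4 → k) : B u (f + g) = B u f + B u g := by
  simp [B]; ring
lemma B_smul_right (c : k) (g u : Fin 4 → k) : B u (c • g) = c * B u g := by
  simp [B]; ring

lemma span_be_iso {f g : Fin 4 → k} (hB : B f g = 0) {x y : Fin 4 → k}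
    (hx : x ∈ Submodule.span k {be f, be g}) (hy : y ∈ Submodule.span k {be f, be g}) : B x y = 0 := by
  have hB' : B g f = 0 := by rw [B_swap, hB, neg_zero]
  obtain ⟨a, b, rfl⟩ := Submodule.mem_span_pair.1 hx
  obtain ⟨c, d, rfl⟩ := Submodule.mem_span_pair.1 hy
  simp [B_add_left, B_add_right, B_smul_left, B_smul_right, B_be, B_self, hB, hB']

lemma line_char (W : Submodule k (Fin 4 → k)) (h2 : Module.finrank k W = 2)
    (hW : ∀ x ∈ W, ∀ y ∈ W, B x y = 0) :
    ∃ f g, LinearIndependent k ![f, g] ∧ B f g = 0 ∧ ∀ v, v ∈ W ↔ dt f v = 0 ∧ dt g v = 0 := by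
  let b := Module.finBasisOfFinrankEq k W h2
  have hLI : LinearIndependent k ![(b 0 : Fin 4 → k), (b 1 : Fin 4 → k)] := by
    have := b.linearIndependent.map' W.subtype (Submodule.ker_subtype W)
    have e : ![(b 0 : Fin 4 → k), (b 1 : Fin 4 → k)] = W.subtype ∘ b := by
      funext i; fin_cases i <;> rfl
    rw [e]; exact this
  have hLI' := be_LI hLI
  have hB : B (be (b 0 : Fin 4 → k)) (be (b 1 : Fin 4 → k)) = 0 := by
    rw [B_be]; exact hW _ (b 0).2 _ (b 1).2
  refine ⟨_, _, hLI', hB, fun v => ?_⟩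
  rw [← span_be_mem hLI' hB]
  have : Submodule.span k {be (be (b 0 : Fin 4 → k)), be (be (b 1 : Fin 4 → k))} = W := by
    apply Submodule.eq_of_le_of_finrank_eq
    · rw [Submodule.span_le]
      rintro x (rfl | rfl)
      · rw [be_be]; exact W.neg_mem (b 0).2
      · rw [be_be]; exact W.neg_mem (b 1).2
    · rw [span_be_finrank hLI', h2]
  rw [this]

/-- indicator of nonzero vectors -/
def en (k : Type) [Field k] : Fn k := fun v => if v = 0 then 0 else 1

/-- indicator of a line -/
def zl (f g : Fin 4 → k) : Fn k := fun v => if v ≠ 0 ∧ dt f v = 0 ∧ dt g v = 0 then 1 else 0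

def yl (f : Fin 4 → k) : Fn k := fun v => if v ≠ 0 ∧ dt f v = 0 then 1 else 0

variable (k) in
def ZZ : Submodule k (Fn k) :=
  Submodule.span k {x | ∃ f g, LinearIndependent k ![f, g] ∧ B f g = 0 ∧ x = zl f g}

variable {q : ℕ} 

lemma pow_ind (hq : Fintype.card k = q) (x : k) : x ^ (q-1) = if x = 0 then 0 else 1 := by
  have h1 : 1 < q := hq ▸ Fintype.one_lt_card
  split_ifs with h
  · rw [h, zero_pow (by omega)]
  · rw [← hq]; exact FiniteField.pow_card_sub_one_eq_one x h

lemma gn_self (hq : Fintype.card k = q) (f : Fin 4 → k) : gn k q f f = en k - yl f := by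
  funext v
  simp only [gn, pow_ind hq, en, yl, Pi.sub_apply]
  by_cases hv : v = 0
  · subst hv; simp [dt_zero_r]
  · by_cases h : dt f v = 0 <;> simp [h, hv]

lemma zl_eq (hq : Fintype.card k = q) (f g : Fin 4 → k) :
    zl f g = en k - gn k q f f - gn k q g g + gn k q f g := by
  funext v
  simp only [gn, pow_ind hq, en, zl, Pi.sub_apply, Pi.add_apply]
  by_cases hv : v = 0
  · subst hv; simp [dt_zero_r]
  · by_cases h : dt f v = 0 <;> by_cases h' : dt g v = 0 <;> simp [h, h', hv]

/-- pencil counting -/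
lemma pencil (a b : k) : (∑ s : k, (if a + s * b = 0 then (1:k) else 0)) + (if b = 0 then 1 else 0) = 1 := by
  by_cases hb : b = 0
  · subst hb
    simp
  · rw [if_neg hb, add_zero, Finset.sum_eq_single (-a / b)]
    · rw [if_pos]; field_simp; ring
    · intro s _ hs
      rw [if_neg]
      intro h
      apply hs
      field_simp
      linear_combination h
    · simp

lemma yl_pencil (f g h : Fin 4 → k) : yl f = (∑ s : k, zl f (g + s • h)) + zl f h := by
  funext v
  simp only [Pi.add_apply, Finset.sum_apply, yl, zl, dt_add_l, dt_smul_l]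
  by_cases hv : v ≠ 0 ∧ dt f v = 0
  · rw [if_pos hv]
    simp only [hv.1, hv.2, true_and, ne_eq, not_false_eq_true]
    exact (pencil _ _).symm
  · rw [if_neg hv]
    have : ∀ P : Prop, ¬ (v ≠ 0 ∧ dt f v = 0 ∧ P) := fun P hP => hv ⟨hP.1, hP.2.1⟩
    simp only [this, if_false]; simp

lemma en_pencil (g h : Fin 4 → k) : en k = (∑ s : k, yl (g + s • h)) + yl h := by
  funext v
  simp only [Pi.add_apply, Finset.sum_apply, yl, en, dt_add_l, dt_smul_l]
  by_cases hv : v = 0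
  · simp [hv]
  · simp only [hv, true_and, ne_eq, not_false_eq_true, if_false]
    exact (pencil _ _).symm

lemma exists_perp {f : Fin 4 → k} (hf : f ≠ 0) : ∃ g h : Fin 4 → k, B f g = 0 ∧ B f h = 0 ∧
    ∀ a b c : k, a • f + b • g + c • h = 0 → a = 0 ∧ b = 0 ∧ c = 0 := by
  have hf' : f 0 ≠ 0 ∨ f 1 ≠ 0 ∨ f 2 ≠ 0 ∨ f 3 ≠ 0 := by
    by_contra hcon
    push Not at hcon
    apply hf
    funext j; fin_cases j
    · exact hcon.1
    · exact hcon.2.1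
    · exact hcon.2.2.1
    · exact hcon.2.2.2
  rcases hf' with h0 | h0 | h0 | h0
  · refine ⟨![0, f 3 / f 0, 1, 0], ![0, -f 2 / f 0, 0, 1], ?_, ?_, ?_⟩
    · simp [B]; field_simp; ring
    · simp [B]; field_simp; ring
    · intro a b c h
      have e0 := congrFun h 0
      have e1 := congrFun h 2
      have e2 := congrFun h 3
      simp only [Pi.add_apply, Pi.smul_apply, smul_eq_mul, Pi.zero_apply, Matrix.cons_val, mul_zero,
        mul_one, add_zero, zero_add] at e0 e1 e2
      have e0 := (mul_eq_zero.1 e0).resolve_right h0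
      subst e0
      rw [zero_mul, zero_add] at e1 e2
      exact ⟨rfl, e1, e2⟩
  · refine ⟨![-f 3 / f 1, 0, 1, 0], ![f 2 / f 1, 0, 0, 1], ?_, ?_, ?_⟩
    · simp [B]; field_simp; ring
    · simp [B]; field_simp; ring
    · intro a b c h
      have e0 := congrFun h 1
      have e1 := congrFun h 2
      have e2 := congrFun h 3
      simp only [Pi.add_apply, Pi.smul_apply, smul_eq_mul, Pi.zero_apply, Matrix.cons_val, mul_zero,
        mul_one, add_zero, zero_add] at e0 e1 e2
      have e0 := (mul_eq_zero.1 e0).resolve_right h0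
      subst e0
      rw [zero_mul, zero_add] at e1 e2
      exact ⟨rfl, e1, e2⟩
  · refine ⟨![1, 0, 0, f 1 / f 2], ![0, 1, 0, -f 0 / f 2], ?_, ?_, ?_⟩
    · simp [B]; field_simp; ring
    · simp [B]; field_simp; ring
    · intro a b c h
      have e0 := congrFun h 2
      have e1 := congrFun h 0
      have e2 := congrFun h 1
      simp only [Pi.add_apply, Pi.smul_apply, smul_eq_mul, Pi.zero_apply, Matrix.cons_val, mul_zero,
        mul_one, add_zero, zero_add] at e0 e1 e2
      have e0 := (mul_eq_zero.1 e0).resolve_right h0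
      subst e0
      rw [zero_mul, zero_add] at e1 e2
      exact ⟨rfl, e1, e2⟩
  · refine ⟨![1, 0, -f 1 / f 3, 0], ![0, 1, f 0 / f 3, 0], ?_, ?_, ?_⟩
    · simp [B]; field_simp; ring
    · simp [B]; field_simp; ring
    · intro a b c h
      have e0 := congrFun h 3
      have e1 := congrFun h 0
      have e2 := congrFun h 1
      simp only [Pi.add_apply, Pi.smul_apply, smul_eq_mul, Pi.zero_apply, Matrix.cons_val, mul_zero,
        mul_one, add_zero, zero_add] at e0 e1 e2
      have e0 := (mul_eq_zero.1 e0).resolve_right h0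
      subst e0
      rw [zero_mul, zero_add] at e1 e2
      exact ⟨rfl, e1, e2⟩

lemma yl_mem {f : Fin 4 → k} (hf : f ≠ 0) : yl f ∈ ZZ k := by
  obtain ⟨g, h, hg, hh, hi⟩ := exists_perp hf
  rw [yl_pencil f g h]
  refine Submodule.add_mem _ (Submodule.sum_mem _ fun s _ => Submodule.subset_span ⟨_, _, ?_, ?_, rfl⟩)
    (Submodule.subset_span ⟨_, _, ?_, hh, rfl⟩)
  · rw [LinearIndependent.pair_iff]
    intro a b hab
    have := hi a b (b * s) (by rw [← hab, smul_add, smul_smul, add_assoc])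
    exact ⟨this.1, this.2.1⟩
  · rw [B_add_right, B_smul_right, hg, hh]; simp
  · rw [LinearIndependent.pair_iff]
    intro a b hab
    have := hi a 0 b (by rw [← hab]; simp)
    exact ⟨this.1, this.2.2⟩

lemma en_mem : en k ∈ ZZ k := by
  rw [en_pencil ![1,0,0,0] ![0,1,0,0]]
  refine Submodule.add_mem _ (Submodule.sum_mem _ fun s _ => yl_mem ?_) (yl_mem ?_)
  · intro h
    have := congrFun h 0
    simp at this
  · intro h
    have := congrFun h 1
    simp at this

lemma gn_self_mem (hq : Fintype.card k = q) (f : Fin 4 → k) : gn k q f f ∈ ZZ k := by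
  have h1 : 1 < q := hq ▸ Fintype.one_lt_card
  by_cases hf : f = 0
  · have : gn k q f f = 0 := by
      funext v
      rw [hf, gn, dt_zero_l, zero_pow (by omega)]; simp
    rw [this]; exact Submodule.zero_mem _
  · rw [gn_self hq]
    exact Submodule.sub_mem _ en_mem (yl_mem hf)

lemma gn_mem (hq : Fintype.card k = q) {f g : Fin 4 → k} (hB : B f g = 0) : gn k q f g ∈ ZZ k := by
  have h1 : 1 < q := hq ▸ Fintype.one_lt_card
  by_cases hf : f = 0
  · have : gn k q f g = 0 := by
      funext v
      rw [hf, gn, dt_zero_l, zero_pow (by omega)]; simp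
    rw [this]; exact Submodule.zero_mem _
  by_cases hi : LinearIndependent k ![f, g]
  · have : gn k q f g = zl f g - en k + gn k q f f + gn k q g g := by rw [zl_eq hq]; abel
    rw [this]
    exact Submodule.add_mem _ (Submodule.add_mem _ (Submodule.sub_mem _
      (Submodule.subset_span ⟨_, _, hi, hB, rfl⟩) en_mem) (gn_self_mem hq _)) (gn_self_mem hq _)
  · rw [LinearIndependent.pair_iff' hf] at hi
    push Not at hi
    obtain ⟨a, rfl⟩ := hi
    have : gn k q f (a • f) = a ^ (q-1) • gn k q f f := by
      funext v
      simp only [gn, dt_smul_l, Pi.smul_apply, smul_eq_mul]; ring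
    rw [this]
    exact Submodule.smul_mem _ _ (gn_self_mem hq _)

lemma ZZ_eq (hq : Fintype.card k = q) : ZZ k = Submodule.span k {en k} ⊔ C0 k q := by
  apply le_antisymm
  · rw [ZZ, Submodule.span_le]
    rintro _ ⟨f, g, -, hB, rfl⟩
    have hC : ∀ f g, B f g = 0 → gn k q f g ∈ Submodule.span k {en k} ⊔ C0 k q :=
      fun f g h => Submodule.mem_sup_right (Submodule.subset_span ⟨f, g, h, rfl⟩)
    rw [SetLike.mem_coe, zl_eq hq]
    exact Submodule.add_mem _ (Submodule.sub_mem _ (Submodule.sub_mem _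
      (Submodule.mem_sup_left (Submodule.mem_span_singleton_self _)) (hC _ _ (B_self f)))
      (hC _ _ (B_self g))) (hC _ _ hB)
  · refine sup_le ?_ ?_
    · rw [Submodule.span_singleton_le_iff_mem]; exact en_mem
    · rw [C0, Submodule.span_le]
      rintro _ ⟨f, g, h, rfl⟩
      exact gn_mem hq h

lemma eval_lf (f v : Fin 4 → k) : eval v (lf f) = dt f v := by simp [lf, dt]

lemma sum_gn (hq : Fintype.card k = q) (f g : Fin 4 → k) : ∑ v, gn k q f g v = 0 := by
  have h1 : 1 < q := hq ▸ Fintype.one_lt_card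
  have h := MvPolynomial.sum_eval_eq_zero (lf f ^ (q-1) * lf g ^ (q-1)) (by
    have hl : ∀ f : Fin 4 → k, (lf f).totalDegree ≤ 1 := fun f => IsHomogeneous.totalDegree_le (lf_hom f)
    have h2 : ∀ f : Fin 4 → k, (lf f ^ (q-1)).totalDegree ≤ (q-1) := fun f =>
      (totalDegree_pow _ _).trans (by have := Nat.mul_le_mul_left (q-1) (hl f); omega)
    have := totalDegree_mul (lf f ^ (q-1)) (lf g ^ (q-1))
    have a := h2 f
    have b := h2 g
    rw [Fintype.card_fin, hq]
    omega)
  simpa [eval_lf, gn] using h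

lemma en_not_mem (hq : Fintype.card k = q) : en k ∉ C0 k q := by
  intro h
  let φ : Fn k →ₗ[k] k := ∑ v, LinearMap.proj v
  have hφ : ∀ F : Fn k, φ F = ∑ v, F v := fun F => by simp [φ]
  have h1 : C0 k q ≤ LinearMap.ker φ := by
    rw [C0, Submodule.span_le]
    rintro _ ⟨f, g, -, rfl⟩
    rw [SetLike.mem_coe, LinearMap.mem_ker, hφ, sum_gn hq]
  have h2 := h1 h
  rw [LinearMap.mem_ker, hφ] at h2
  have h3 : ∀ v, en k v = 1 - if v = 0 then 1 else 0 := fun v => by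
    by_cases hv : v = 0 <;> simp [en, hv]
  simp [h3] at h2

lemma finrank_ZZ (hq : Fintype.card k = q) : Module.finrank k (ZZ k) = 1 + Module.finrank k (C0 k q) := by
  rw [ZZ_eq hq]
  have hne : en k ≠ 0 := fun h => en_not_mem hq (h ▸ Submodule.zero_mem _)
  have hd : Disjoint (Submodule.span k {en k}) (C0 k q) := by
    rw [disjoint_comm, Submodule.disjoint_span_singleton' hne]
    exact en_not_mem hq
  have := Submodule.finrank_sup_add_finrank_inf_eq (Submodule.span k {en k}) (C0 k q)
  rw [hd.eq_bot, finrank_bot, finrank_span_singleton hne] at this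
  simpa using this

end lines

section descent
variable {F K : Type} [Field F] [Field K] [Algebra F K] {m n : Type} [Fintype m] [Fintype n]

lemma rank_descent (A : Matrix m n F) :
    A.rank = Module.finrank K (Submodule.span K (Set.range fun i : m => fun j : n => algebraMap F K (A i j))) := by
  let φ : (n → F) →ₗ[F] (n → K) := (Algebra.linearMap F K).compLeft n
  change A.rank = Module.finrank K (Submodule.span K (Set.range fun i : m => φ (A.row i)))
  rw [Matrix.rank_eq_finrank_span_row]
  obtain ⟨b, hb, hs, hi⟩ := exists_linearIndependent F (Set.range A.row)
  have hfin : b.Finite := (Set.finite_range _).subset hb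
  haveI := hfin.fintype
  rw [← hs]
  have hi' : LinearIndependent K (fun x : b => φ x.1) := by
    rw [Fintype.linearIndependent_iff] at hi ⊢
    intro c hc x
    rw [← Module.forall_dual_apply_eq_zero_iff F]
    intro l
    refine hi (fun x => l (c x)) ?_ x
    funext j
    have h1 := congrArg l (congrFun hc j)
    simp only [Finset.sum_apply, Pi.smul_apply, smul_eq_mul, Pi.zero_apply, map_zero, map_sum] at h1 ⊢
    rw [← h1]
    refine Finset.sum_congr rfl fun y _ => ?_
    have : c y * φ y.1 j = y.1 j • c y := by
      rw [Algebra.smul_def, mul_comm]; rfl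
    rw [this, map_smul, smul_eq_mul, mul_comm]
  have e1 : Submodule.span K (Set.range fun i => φ (A.row i)) = Submodule.span K (Set.range fun x : b => φ x.1) := by
    apply le_antisymm
    · rw [Submodule.span_le]
      rintro _ ⟨i, rfl⟩
      have h1 : A.row i ∈ Submodule.span F b := by rw [hs]; exact Submodule.subset_span ⟨i, rfl⟩
      have h2 : φ (A.row i) ∈ (Submodule.span F b).map φ := ⟨_, h1, rfl⟩
      rw [Submodule.map_span] at h2
      have h3 : Submodule.span F (φ '' b) ≤
          (Submodule.span K (Set.range fun x : b => φ x.1)).restrictScalars F := by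
        rw [Submodule.span_le]
        rintro _ ⟨x, hx, rfl⟩
        exact Submodule.subset_span ⟨⟨x, hx⟩, rfl⟩
      exact h3 h2
    · rw [Submodule.span_le]
      rintro _ ⟨x, rfl⟩
      obtain ⟨i, hx⟩ := hb x.2
      exact Submodule.subset_span ⟨i, by simp only [hx]⟩
  rw [e1, finrank_span_eq_card hi', finrank_span_set_eq_card hi]
  simp [Set.toFinset_card]

end descent
end W3


namespace W3
section glue
variable (p t : ℕ) [Fact p.Prime]

def tau : (Fin 4 → GaloisField p t) ≃ₗ[GaloisField p t] SympV p t 2 where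
  toFun v := (![v 0, v 2], ![v 1, v 3])
  invFun w := ![w.1 0, w.2 0, w.1 1, w.2 1]
  map_add' u v := by
    ext i <;> fin_cases i <;> simp
  map_smul' c v := by
    ext i <;> fin_cases i <;> simp
  left_inv v := by
    ext i; fin_cases i <;> simp
  right_inv w := by
    ext i <;> fin_cases i <;> simp

lemma sform_tau (u w : Fin 4 → GaloisField p t) : sform (tau p t u) (tau p t w) = B u w := by
  simp [sform, tau, B, Fin.sum_univ_two]
  ring

lemma sform_symm (u w : SympV p t 2) : sform u w = B ((tau p t).symm u) ((tau p t).symm w) := by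
  rw [← sform_tau]; simp

def ptOf (v : Fin 4 → GaloisField p t) (hv : v ≠ 0) : Pts p t 2 :=
  ⟨Submodule.span (GaloisField p t) {tau p t v},
    finrank_span_singleton (by simpa using hv)⟩

lemma ptOf_surj (Z : Pts p t 2) : ∃ v, ∃ hv : v ≠ 0, ptOf p t v hv = Z := by
  obtain ⟨w, hw, hs⟩ := finrank_eq_one_iff'.1 Z.2
  refine ⟨(tau p t).symm w, by simpa using hw, ?_⟩
  apply Subtype.ext
  simp only [ptOf, LinearEquiv.apply_symm_apply]
  apply le_antisymm
  · rw [Submodule.span_singleton_le_iff_mem]; exact w.2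
  · intro x hx
    obtain ⟨c, hc⟩ := hs ⟨x, hx⟩
    rw [Submodule.mem_span_singleton]
    exact ⟨c, congrArg Subtype.val hc⟩

def Psi : (Pts p t 2 → GaloisField p t) →ₗ[GaloisField p t] Fn (GaloisField p t) where
  toFun h v := if hv : v = 0 then 0 else h (ptOf p t v hv)
  map_add' a b := by
    funext v; by_cases hv : v = 0 <;> simp [hv]
  map_smul' c a := by
    funext v; by_cases hv : v = 0 <;> simp [hv]

lemma Psi_inj : Function.Injective (Psi p t) := by
  intro a b hab
  funext Z
  obtain ⟨v, hv, rfl⟩ := ptOf_surj p t Z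
  have := congrFun hab v
  simpa [Psi, hv] using this

def rowK (W : IsoFlats p t 2 2) : Pts p t 2 → GaloisField p t :=
  fun Z => algebraMap (ZMod p) (GaloisField p t) (incMat p t 2 2 W Z)

lemma Psi_row (W : IsoFlats p t 2 2) (v : Fin 4 → GaloisField p t) :
    Psi p t (rowK p t W) v = if v ≠ 0 ∧ tau p t v ∈ W.val then 1 else 0 := by
  by_cases hv : v = 0
  · simp [Psi, hv]
  · by_cases hW : tau p t v ∈ W.val <;>
      simp [Psi, hv, rowK, incMat, ptOf, Submodule.span_singleton_le_iff_mem, hW]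

lemma rows_eq : Set.range (fun W => Psi p t (rowK p t W)) =
    {x : Fn (GaloisField p t) | ∃ f g, LinearIndependent (GaloisField p t) ![f, g] ∧
      B f g = 0 ∧ x = zl f g} := by
  letI : Fintype (GaloisField p t) := Fintype.ofFinite _
  ext x
  constructor
  · rintro ⟨W, rfl⟩
    have h2 : Module.finrank (GaloisField p t)
        (W.val.map ((tau p t).symm : SympV p t 2 →ₗ[GaloisField p t] (Fin 4 → GaloisField p t))) = 2 := by
      rw [LinearEquiv.finrank_map_eq]; exact W.2.2
    obtain ⟨f, g, h, hB, hm⟩ := line_char _ h2 (by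
      rintro _ ⟨x, hx, rfl⟩ _ ⟨y, hy, rfl⟩
      have := W.2.1 x hx y hy
      rw [sform_symm] at this
      exact this)
    refine ⟨f, g, h, hB, ?_⟩
    funext v
    dsimp only
    rw [Psi_row]
    unfold zl
    have : tau p t v ∈ W.val ↔ dt f v = 0 ∧ dt g v = 0 := by
      rw [← hm]
      constructor
      · intro hv; exact ⟨_, hv, by simp⟩
      · rintro ⟨w, hw, rfl⟩; simpa using hw
    simp only [this]
  · rintro ⟨f, g, h, hB, rfl⟩
    refine ⟨⟨(Submodule.span (GaloisField p t) {be f, be g}).map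
      ((tau p t) : (Fin 4 → GaloisField p t) →ₗ[GaloisField p t] SympV p t 2), ?_, ?_⟩, ?_⟩
    · rintro _ ⟨x, hx, rfl⟩ _ ⟨y, hy, rfl⟩
      have := sform_tau p t x y
      rw [span_be_iso hB hx hy] at this
      exact this
    · rw [LinearEquiv.finrank_map_eq]; exact span_be_finrank h
    · funext v
      dsimp only
      rw [Psi_row]
      unfold zl
      have : tau p t v ∈ (Submodule.span (GaloisField p t) {be f, be g}).map
          ((tau p t) : (Fin 4 → GaloisField p t) →ₗ[GaloisField p t] SympV p t 2) ↔
          dt f v = 0 ∧ dt g v = 0 := by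
        rw [← span_be_mem h hB]
        constructor
        · rintro ⟨w, hw, hwv⟩
          have : w = v := (tau p t).injective hwv
          exact this ▸ hw
        · intro hv; exact ⟨_, hv, rfl⟩
      simp only [this]

lemma rank_eq : (incMat p t 2 2).rank =
    Module.finrank (GaloisField p t) (ZZ (GaloisField p t)) := by
  have h1 : (incMat p t 2 2).rank = Module.finrank (GaloisField p t)
      (Submodule.span (GaloisField p t) (Set.range (rowK p t))) :=
    rank_descent (K := GaloisField p t) (incMat p t 2 2)
  have h2 : ZZ (GaloisField p t) =
      (Submodule.span (GaloisField p t) (Set.range (rowK p t))).map (Psi p t) := by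
    rw [Submodule.map_span, ← Set.range_comp]
    unfold ZZ
    rw [← rows_eq]
    rfl
  rw [h1, h2]
  exact (Submodule.equivMapOfInjective (Psi p t) (Psi_inj p t)
    (Submodule.span (GaloisField p t) (Set.range (rowK p t)))).finrank_eq

end glue
end W3
/-- Theorem (Chandler–Sin–Xiang): the `p`-rank of the point-line incidence matrix of the
symplectic generalized quadrangle `W(3,q)`, `q = p^t`, `p` odd, is `1 + α₁^t + α₂^t`
with `α₁, α₂ = p(p+1)²/4 ± p(p+1)(p−1)√17/12`. -/
theorem prank_W3q (p t : ℕ) [Fact p.Prime] (hodd : Odd p) (ht : 1 ≤ t) :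
    ((incMat p t 2 2).rank : ℝ) =
      1 + ((p : ℝ) * ((p : ℝ) + 1) ^ 2 / 4
            + (p : ℝ) * ((p : ℝ) + 1) * ((p : ℝ) - 1) / 12 * Real.sqrt 17) ^ t
        + ((p : ℝ) * ((p : ℝ) + 1) ^ 2 / 4
            - (p : ℝ) * ((p : ℝ) + 1) * ((p : ℝ) - 1) / 12 * Real.sqrt 17) ^ t := by
  have hp : 3 ≤ p := by
    have h2 := (Fact.out : p.Prime).two_le
    rcases hodd with ⟨r, hr⟩
    omega
  haveI : NeZero t := ⟨by omega⟩
  letI : Fintype (GaloisField p t) := Fintype.ofFinite _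
  have hq : Fintype.card (GaloisField p t) = p ^ t := by
    rw [← Nat.card_eq_fintype_card]; exact GaloisField.card p t (by omega)
  rw [W3.rank_eq, W3.finrank_ZZ hq, W3.finrank_C0 hq hp hodd, Nat.cast_add, W3.count_final p t hp,
    Nat.cast_one, add_assoc]

end
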